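/- arXiv:1904.11807 — 2 statements merged into one kernel-verified Lean document; each statement's English description precedes it below -/
import Mathlib

section
/- Let δ ∈ (0,1] be a constant and let I = (V,E,λ) be a hardcore instance with n = |V|, whose graph G = (V,E) has maximum degree Δ ≥ 3, and with fugacity λ ≤ (2−δ)/(Δ−2). Then there exists a potential function ρ_I: Ω_I × Ω_I → ℝ_{≥0} with ρ_I(σ,τ) = 0 if σ = τ and ρ_I(σ,τ) ≥ 1 if σ ≠ τ, and with Diam_I := max_{σ,τ∈Ω_I} ρ_I(σ,τ) ≤ Δn, such that: (1) (step-wise decay) every one-step optimal coupling (X_t,Y_t)_{t≥0} of the Gibbs sampling chain on I satisfies, for all σ, τ ∈ Ω_I, E[ρ_I(X_t,Y_t) | X_{t−1} = σ ∧ Y_{t−1} = τ] ≤ (1 − (δ/96)/n)·ρ_I(σ,τ), and consequently τ_mix(I,ε) ≤ ⌈(96n/δ)·log(Diam_I/ε)⌉ = O(n log(n/ε)); (2) (upper bound to Hamming) H(σ,τ) ≤ ρ_I(σ,τ) for all σ, τ ∈ Ω_I, where H is the Hamming distance; (3) (Lipschitz) ρ_I, seen as a function of the 2n Boolean coordinates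 of its two arguments, is 12Δ-Lipschitz, i.e., |ρ_I(σ,τ) − ρ_I(σ',τ')| ≤ 12Δ·H(στ, σ'τ') for all σ,σ',τ,τ' ∈ Ω_I. -/
open Finset
open scoped ENNReal

/-- Exponential on `ℝ ∪ {−∞}` (modeled as `WithBot ℝ`), with `exp(−∞) = 0`. -/
noncomputable def expB (x : WithBot ℝ) : ℝ := WithBot.recBotCoe 0 Real.exp x

/-- Total variation distance between two distributions on a finite set. -/
noncomputable def tvDist {Q : Type*} [Fintype Q] (μ ν : Q → ℝ) : ℝ :=
  2⁻¹ * ∑ x, |μ x - ν x|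

/-- `D` is a coupling of the distributions `μ` and `ν` on a finite set. -/
def IsCoupling {Q : Type*} [Fintype Q] (μ ν : Q → ℝ) (D : Q → Q → ℝ) : Prop :=
  (∀ c c', 0 ≤ D c c') ∧ (∀ c, ∑ c', D c c' = μ c) ∧ (∀ c', ∑ c, D c c' = ν c')

/-- `D` is an optimal coupling of `μ` and `ν`: a coupling maximizing the probability
of agreement of the two coordinates. -/
def IsOptimalCoupling {Q : Type*} [Fintype Q] (μ ν : Q → ℝ) (D : Q → Q → ℝ) : Prop :=
  IsCoupling μ ν D ∧
    ∀ D' : Q → Q → ℝ, IsCoupling μ ν D' → ∑ c, D' c c ≤ ∑ c, D c c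

/-- Distribution of a finite-state Markov chain with transition kernel `P` after `t` steps,
started from the initial distribution `init`. -/
noncomputable def chainDist {S : Type*} [Fintype S] (P : S → S → ℝ) (init : S → ℝ) :
    ℕ → S → ℝ
  | 0 => init
  | t + 1 => fun s' => ∑ s, chainDist P init t s * P s s'

/-- Point mass at `s0`. -/
noncomputable def initDelta {S : Type*} [DecidableEq S] (s0 : S) : S → ℝ :=
  fun s => if s = s0 then 1 else 0

/-- Transition kernel of a coupled pair of single-site (Gibbs-sampling style) chains:
a uniformly random vertex `v` is picked, all other coordinates of both copies are copied,
and the pair of new values at `v` is drawn from the local coupling `Dloc v`. -/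
noncomputable def pairKernel {V Q : Type*} [Fintype V] [Fintype Q]
    (Dloc : V → (V → Q) → (V → Q) → Q → Q → ℝ)
    (p p' : (V → Q) × (V → Q)) : ℝ := by
  classical
  exact (Fintype.card V : ℝ)⁻¹ * ∑ v,
    (if (∀ u, u ≠ v → p'.1 u = p.1 u) ∧ (∀ u, u ≠ v → p'.2 u = p.2 u)
      then Dloc v p.1 p.2 (p'.1 v) (p'.2 v) else 0)

/-- The resampling probability `p(c)` used in the local coupling for Hamiltonian update. -/
noncomputable def pResample {Q : Type*} (μ μ' : Q → ℝ) (c : Q) : ℝ := by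
  classical
  exact if μ c ≤ μ' c then 0 else (μ c - μ' c) / μ c

/-- The resampling distribution `ν` used in the local coupling for Hamiltonian update. -/
noncomputable def nuResample {Q : Type*} [Fintype Q] (μ μ' : Q → ℝ) (b : Q) : ℝ :=
  max 0 (μ' b - μ b) / ∑ x, max 0 (μ x - μ' x)

/-- The joint law of the local coupling for Hamiltonian update: first `(c,c')` is drawn from
the optimal coupling `Dopt`, then with probability `pResample μ μ' c'` the second coordinate
is resampled from `nuResample μ μ'`. -/
noncomputable def hamCoupling {Q : Type*} [Fintype Q] (μ μ' : Q → ℝ)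
    (Dopt : Q → Q → ℝ) (c d : Q) : ℝ :=
  Dopt c d * (1 - pResample μ μ' d) +
    nuResample μ μ' d * ∑ c', Dopt c c' * pResample μ μ' c'

/-- Indicator (as a real number) of the event `v ∈ Γ⁺(D)`, where `D` is the set of
disagreements between the two coordinates of the pair state `p`. -/
noncomputable def indNbr {V Q : Type*} [Fintype V] (G : SimpleGraph V)
    (p : (V → Q) × (V → Q)) (v : V) : ℝ := by
  classical
  exact if (∃ u, (u = v ∨ G.Adj v u) ∧ p.1 u ≠ p.2 u) then 1 else 0

/-- `v` is incident to an edge of the symmetric difference of the edge sets of `G` and `G'`. -/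
def inS {V : Type*} (G G' : SimpleGraph V) (v : V) : Prop :=
  ∃ u, (G.Adj v u ∧ ¬ G'.Adj v u) ∨ (G'.Adj v u ∧ ¬ G.Adj v u)

/-- Indicator (as a real number) of the event `v ∈ S ∪ Γ_G⁺(D)`. -/
noncomputable def indSnbr {V Q : Type*} [Fintype V] (G G' : SimpleGraph V)
    (p : (V → Q) × (V → Q)) (v : V) : ℝ := by
  classical
  exact if inS G G' v ∨ (∃ u, (u = v ∨ G.Adj v u) ∧ p.1 u ≠ p.2 u) then 1 else 0

/-- A configuration `σ : V → Bool` is feasible for the hardcore model on `G`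
(its support is an independent set). -/
def IsIndep {V : Type*} (G : SimpleGraph V) (σ : V → Bool) : Prop :=
  ∀ u v, G.Adj u v → ¬(σ u = true ∧ σ v = true)

/-- Conditional marginal distribution at `v` of the hardcore model on `G` with fugacity `lam`,
given the configuration `τ` on the neighborhood of `v`. -/
noncomputable def margHC {V : Type*} [Fintype V] (G : SimpleGraph V) [DecidableRel G.Adj]
    (lam : ℝ) (v : V) (τ : V → Bool) (b : Bool) : ℝ := by
  classical
  exact (if b then (if ∀ u ∈ G.neighborFinset v, τ u = false then lam else 0) else 1) /
    (1 + (if ∀ u ∈ G.neighborFinset v, τ u = false then lam else 0))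

/-- Unnormalized hardcore weight `λ^{‖σ‖}` of a feasible configuration (and `0` otherwise). -/
noncomputable def hcWeight {V : Type*} [Fintype V] (G : SimpleGraph V)
    (lam : ℝ) (σ : V → Bool) : ℝ := by
  classical
  exact if IsIndep G σ then lam ^ (Finset.univ.filter fun v => σ v = true).card else 0

/-- The hardcore Gibbs distribution `μ_I(σ) ∝ λ^{‖σ‖}` on independent-set configurations. -/
noncomputable def hcGibbs {V : Type*} [Fintype V] [DecidableEq V] (G : SimpleGraph V)
    (lam : ℝ) (σ : V → Bool) : ℝ :=
  hcWeight G lam σ / ∑ σ' : V → Bool, hcWeight G lam σ'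

/-- Transition kernel of the Gibbs sampling chain of the hardcore model. -/
noncomputable def gibbsStepHC {V : Type*} [Fintype V] (G : SimpleGraph V) [DecidableRel G.Adj]
    (lam : ℝ) (σ σ' : V → Bool) : ℝ := by
  classical
  exact (Fintype.card V : ℝ)⁻¹ *
    ∑ v, (if ∀ u, u ≠ v → σ' u = σ u then margHC G lam v σ (σ' v) else 0)

/-! ### The potential: disagreements plus blocking disagreements -/

open Classical in
/-- The real-valued indicator of a proposition. -/
noncomputable def ind (P : Prop) : ℝ := if P then 1 else 0

lemma ind_of {P : Prop} (h : P) : ind P = 1 := if_pos h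

lemma ind_of_not {P : Prop} (h : ¬ P) : ind P = 0 := if_neg h

@[simp] lemma ind_true : ind True = 1 := ind_of trivial

@[simp] lemma ind_false : ind False = 0 := ind_of_not not_false

lemma ind_nonneg (P : Prop) : 0 ≤ ind P := by
  by_cases h : P <;> simp [h]

lemma ind_le_one (P : Prop) : ind P ≤ 1 := by
  by_cases h : P <;> simp [h]

lemma ind_mono {P Q : Prop} (h : P → Q) : ind P ≤ ind Q := by
  by_cases hP : P
  · simp [hP, h hP]
  · simpa [hP] using ind_nonneg Q

/-- No neighbour of `v` is occupied in `σ`. -/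
def SiteFree {V : Type*} (G : SimpleGraph V) (σ : V → Bool) (v : V) : Prop :=
  ∀ u, G.Adj v u → σ u = false

/-- Indicator of a disagreement at `v`. -/
noncomputable def disagr {V : Type*} (σ τ : V → Bool) (v : V) : ℝ :=
  ind (σ v ≠ τ v)

/-- Indicator that `v` is blocked in exactly one of `σ` and `τ`. -/
noncomputable def blockDisagr {V : Type*} (G : SimpleGraph V) (σ τ : V → Bool) (v : V) : ℝ :=
  ind (¬ (SiteFree G σ v ↔ SiteFree G τ v))

/-- Indicator that `v` is unblocked in both `σ` and `τ`. -/
noncomputable def bothFree {V : Type*} (G : SimpleGraph V) (σ τ : V → Bool) (v : V) : ℝ :=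
  ind (SiteFree G σ v ∧ SiteFree G τ v)

/-- Indicator that `v` is occupied and has an occupied neighbour. -/
noncomputable def conflict {V : Type*} (G : SimpleGraph V) (σ : V → Bool) (v : V) : ℝ :=
  ind (σ v = true ∧ ¬ SiteFree G σ v)

open Classical in
/-- Occupy `v` if it is unblocked, and vacate it otherwise. -/
noncomputable def tryOccupy {V : Type*} [DecidableEq V] (G : SimpleGraph V) (σ : V → Bool)
    (v : V) : V → Bool :=
  Function.update σ v (decide (SiteFree G σ v))

/-- Vacate `v`. -/
def vacate {V : Type*} [DecidableEq V] (σ : V → Bool) (v : V) : V → Bool :=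
  Function.update σ v false

section LocalChanges

variable {V : Type*} (G : SimpleGraph V)

lemma conflict_eq_zero {σ : V → Bool} (h : IsIndep G σ) (v : V) : conflict G σ v = 0 := by
  refine ind_of_not ?_
  rintro ⟨h1, h2⟩
  exact h2 fun u hu => by simpa [h1] using h v u hu

variable [DecidableEq V]

lemma siteFree_update_of_not_adj {σ : V → Bool} {y v : V} (h : ¬ G.Adj y v) (b : Bool) :
    SiteFree G (Function.update σ v b) y ↔ SiteFree G σ y := by
  unfold SiteFree
  refine forall_congr' fun u => imp_congr_right fun hu => ?_
  have : u ≠ v := by rintro rfl; exact h hu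
  rw [Function.update_of_ne this]

lemma siteFree_update_of_adj {σ : V → Bool} {y v : V} (h : G.Adj y v) (b : Bool) :
    SiteFree G (Function.update σ v b) y ↔
      b = false ∧ ∀ u, G.Adj y u → u ≠ v → σ u = false := by
  constructor
  · intro H
    refine ⟨by simpa using H v h, fun u hu huv => ?_⟩
    have := H u hu
    rwa [Function.update_of_ne huv] at this
  · rintro ⟨rfl, H⟩ u hu
    by_cases huv : u = v
    · subst huv; simp
    · rw [Function.update_of_ne huv]; exact H u hu huv

lemma siteFree_iff_of_adj {σ : V → Bool} {y v : V} (h : G.Adj y v) :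
    SiteFree G σ y ↔ σ v = false ∧ ∀ u, G.Adj y u → u ≠ v → σ u = false := by
  simpa using siteFree_update_of_adj (σ := σ) G h (σ v)

lemma blockDisagr_tryOccupy_le (σ τ : V → Bool) (y v : V) :
    blockDisagr G (tryOccupy G σ v) (tryOccupy G τ v) y - blockDisagr G σ τ y ≤
      ind (G.Adj y v) * (bothFree G σ τ y * blockDisagr G σ τ v -
        blockDisagr G σ τ y * bothFree G σ τ v + conflict G σ v + conflict G τ v) := by
  by_cases h : G.Adj y v
  · simp only [blockDisagr, tryOccupy, siteFree_update_of_adj G h, bothFree, conflict, ind_of h,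
      siteFree_iff_of_adj G (σ := σ) h, siteFree_iff_of_adj G (σ := τ) h, decide_eq_false_iff_not]
    generalize SiteFree G σ v = f
    generalize SiteFree G τ v = f'
    generalize (∀ u, G.Adj y u → u ≠ v → σ u = false) = e
    generalize (∀ u, G.Adj y u → u ≠ v → τ u = false) = e'
    by_cases f <;> by_cases f' <;> by_cases e <;> by_cases e' <;> cases σ v <;> cases τ v <;>
      simp_all
  · simp [blockDisagr, tryOccupy, siteFree_update_of_not_adj G h, h]

lemma disagr_update (σ τ : V → Bool) (v u : V) (b b' : Bool) :
    disagr (Function.update σ v b) (Function.update τ v b') u =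
      disagr σ τ u + if u = v then ind (b ≠ b') - disagr σ τ u else 0 := by
  by_cases h : u = v
  · subst h; simp [disagr]
  · simp [disagr, h]

lemma conflict_update_le (σ : V → Bool) (v u : V) (b : Bool) (hb : b = true → SiteFree G σ v) :
    conflict G (Function.update σ v b) u ≤
      conflict G σ u - if u = v then conflict G σ u else 0 := by
  by_cases h : u = v
  · subst h
    have : SiteFree G (Function.update σ u b) u ↔ SiteFree G σ u :=
      siteFree_update_of_not_adj G (G.irrefl) b
    simp only [conflict, this, Function.update_self]
    rw [ind_of_not]
    · simp
    · exact fun ⟨h1, h2⟩ => h2 (hb h1)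
  · simp only [h, if_false, sub_zero]
    refine ind_mono ?_
    rw [Function.update_of_ne h]
    rintro ⟨hu, hf⟩
    refine ⟨hu, fun hσ => hf ?_⟩
    by_cases ha : G.Adj u v
    · rw [siteFree_update_of_adj G ha]
      refine ⟨?_, fun w hw _ => hσ w hw⟩
      by_contra hb'
      have := hb (by simpa using hb') u ha.symm
      simp [hu] at this
    · rwa [siteFree_update_of_not_adj G ha]

end LocalChanges

/-- Deleting each element in turn: the total change of the indicator that exactly one of
`S`, `T` is empty. -/
lemma sum_erase_empty_le {V : Type*} [Fintype V] [DecidableEq V] (S T : Finset V) :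
    ∑ v, (ind (¬ (S.erase v = ∅ ↔ T.erase v = ∅)) - ind (¬ (S = ∅ ↔ T = ∅))) ≤
      ((symmDiff S T).card : ℝ) - 2 * ind (¬ (S = ∅ ↔ T = ∅)) := by
  have single : ∀ (S : Finset V) (v : V), S ≠ ∅ → (S.erase v = ∅ ↔ S = {v}) := by
    intro S v hS
    rw [Finset.erase_eq_empty_iff]
    simp [hS]
  have one_empty : ∀ T : Finset V, T ≠ ∅ →
      ∑ v, (ind (¬ T.erase v = ∅) - 1) ≤ (T.card : ℝ) - 2 := by
    intro T hT
    have hT' : T.Nonempty := Finset.nonempty_iff_ne_empty.2 hT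
    by_cases h1 : T.card = 1
    · obtain ⟨a, rfl⟩ := Finset.card_eq_one.1 h1
      have : ∀ v, ind (¬ ({a} : Finset V).erase v = ∅) - 1 = if v = a then -1 else 0 := by
        intro v
        by_cases h : v = a
        · simp [h]
        · simp [h]
      simp only [this]
      simp
      norm_num
    · have h2 : 2 ≤ T.card := by have := hT'.card_pos; omega
      have h2' : (2 : ℝ) ≤ T.card := by exact_mod_cast h2
      have : ∑ v, (ind (¬ T.erase v = ∅) - 1) ≤ 0 :=
        Finset.sum_nonpos fun v _ => by linarith [ind_le_one (¬ T.erase v = ∅)]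
      linarith
  by_cases hS : S = ∅
  · by_cases hT : T = ∅
    · simp [hS, hT]
    · subst hS
      have e0 : symmDiff ∅ T = T := bot_symmDiff T
      simpa [hT, e0] using one_empty T hT
  · by_cases hT : T = ∅
    · subst hT
      have e0 : symmDiff S ∅ = S := symmDiff_bot S
      simpa [hS, e0] using one_empty S hS
    · simp only [single T _ hT, single S _ hS, hS, hT, iff_self, not_true_eq_false, ind_false,
        mul_zero, sub_zero]
      classical
      have e : ∑ v, ind (¬ (S = {v} ↔ T = {v})) =
          ((univ.filter fun v => ¬ (S = {v} ↔ T = {v})).card : ℝ) := by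
        rw [Finset.card_filter]
        push_cast
        exact Finset.sum_congr rfl fun v _ => by
          by_cases h : S = {v} ↔ T = {v} <;> simp [h]
      rw [e]
      norm_cast
      by_cases hs : ∃ a, S = {a}
      · obtain ⟨a, rfl⟩ := hs
        by_cases ht : ∃ b, T = {b}
        · obtain ⟨b, rfl⟩ := ht
          refine Finset.card_le_card fun v hv => ?_
          simp only [Finset.mem_filter, Finset.mem_univ, true_and, Finset.singleton_inj] at hv
          simp only [Finset.mem_symmDiff, Finset.mem_singleton]
          grind
        · have h1 : (univ.filter fun v => ¬ (({a} : Finset V) = {v} ↔ T = {v})) ⊆ {a} := by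
            intro v hv
            simp only [Finset.mem_filter, Finset.mem_univ, true_and, Finset.singleton_inj] at hv
            simp only [Finset.mem_singleton]
            grind
          refine (Finset.card_le_card h1).trans ?_
          rw [Finset.card_singleton, Nat.one_le_iff_ne_zero, Finset.card_ne_zero,
            Finset.nonempty_iff_ne_empty, ← Finset.bot_eq_empty, Ne, symmDiff_eq_bot]
          exact fun h => ht ⟨a, h.symm⟩
      · by_cases ht : ∃ b, T = {b}
        · obtain ⟨b, rfl⟩ := ht
          have h1 : (univ.filter fun v => ¬ (S = {v} ↔ ({b} : Finset V) = {v})) ⊆ {b} := by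
            intro v hv
            simp only [Finset.mem_filter, Finset.mem_univ, true_and, Finset.singleton_inj] at hv
            simp only [Finset.mem_singleton]
            grind
          refine (Finset.card_le_card h1).trans ?_
          rw [Finset.card_singleton, Nat.one_le_iff_ne_zero, Finset.card_ne_zero,
            Finset.nonempty_iff_ne_empty, ← Finset.bot_eq_empty, Ne, symmDiff_eq_bot]
          exact fun h => hs ⟨b, h⟩
        · push Not at hs ht
          simp [hs, ht]

section Drift

variable {V : Type*} [Fintype V] (G : SimpleGraph V)

/-- The number of disagreements. -/
noncomputable def numDisagr (σ τ : V → Bool) : ℝ := ∑ v, disagr σ τ v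

/-- The number of sites blocked in exactly one of `σ` and `τ`. -/
noncomputable def numBlockDisagr (σ τ : V → Bool) : ℝ := ∑ v, blockDisagr G σ τ v

/-- The number of occupied sites with an occupied neighbour. -/
noncomputable def numConflict (σ : V → Bool) : ℝ := ∑ v, conflict G σ v

/-- The potential on arbitrary, possibly infeasible, pairs of configurations. -/
noncomputable def potential (c : ℝ) (σ τ : V → Bool) : ℝ :=
  numDisagr σ τ + c * numBlockDisagr G σ τ + 3 * (numConflict G σ + numConflict G τ)

lemma numDisagr_nonneg (σ τ : V → Bool) : 0 ≤ numDisagr σ τ :=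
  Finset.sum_nonneg fun _ _ => ind_nonneg _

lemma numBlockDisagr_nonneg (σ τ : V → Bool) : 0 ≤ numBlockDisagr G σ τ :=
  Finset.sum_nonneg fun _ _ => ind_nonneg _

lemma numConflict_nonneg (σ : V → Bool) : 0 ≤ numConflict G σ :=
  Finset.sum_nonneg fun _ _ => ind_nonneg _

lemma sum_ind_le_card (P : V → Prop) : ∑ v, ind (P v) ≤ Fintype.card V := by
  simpa using Finset.sum_le_card_nsmul univ (fun v => ind (P v)) 1 fun v _ => ind_le_one _

lemma numConflict_eq_zero {σ : V → Bool} (h : IsIndep G σ) : numConflict G σ = 0 :=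
  Finset.sum_eq_zero fun v _ => conflict_eq_zero G h v

lemma numDisagr_eq_hammingDist (σ τ : V → Bool) : numDisagr σ τ = hammingDist σ τ := by
  unfold numDisagr hammingDist disagr
  rw [Finset.card_filter]
  push_cast
  exact Finset.sum_congr rfl fun v _ => by by_cases h : σ v = τ v <;> simp [h]

lemma sum_ind_adj_le [DecidableRel G.Adj] (v : V) : ∑ y, ind (G.Adj y v) ≤ G.maxDegree := by
  have : ∑ y, ind (G.Adj y v) = G.degree v := by
    rw [← G.card_neighborFinset_eq_degree, G.neighborFinset_eq_filter, Finset.card_filter]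
    push_cast
    exact Finset.sum_congr rfl fun y _ => by
      by_cases h : G.Adj v y <;> simp [h, G.adj_comm y v]
  rw [this]
  exact_mod_cast G.degree_le_maxDegree v

lemma sum_sum_adj_mul_le [DecidableRel G.Adj] (f : V → ℝ) (hf : ∀ v, 0 ≤ f v) :
    ∑ v, ∑ y, ind (G.Adj y v) * f v ≤ G.maxDegree * ∑ v, f v := by
  rw [Finset.mul_sum]
  refine Finset.sum_le_sum fun v _ => ?_
  rw [← Finset.sum_mul]
  exact mul_le_mul_of_nonneg_right (sum_ind_adj_le G v) (hf v)

variable [DecidableEq V]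

lemma numDisagr_update (σ τ : V → Bool) (v : V) (b b' : Bool) :
    numDisagr (Function.update σ v b) (Function.update τ v b') =
      numDisagr σ τ + (ind (b ≠ b') - disagr σ τ v) := by
  simp only [numDisagr, disagr_update, Finset.sum_add_distrib]
  simp

lemma numDisagr_tryOccupy (σ τ : V → Bool) (v : V) :
    numDisagr (tryOccupy G σ v) (tryOccupy G τ v) =
      numDisagr σ τ + (blockDisagr G σ τ v - disagr σ τ v) := by
  rw [tryOccupy, tryOccupy, numDisagr_update, blockDisagr]
  simp

lemma numDisagr_vacate (σ τ : V → Bool) (v : V) :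
    numDisagr (vacate σ v) (vacate τ v) = numDisagr σ τ - disagr σ τ v := by
  rw [vacate, vacate, numDisagr_update]
  simp [sub_eq_add_neg]

lemma numConflict_update_le (σ : V → Bool) (v : V) (b : Bool)
    (hb : b = true → SiteFree G σ v) :
    numConflict G (Function.update σ v b) ≤ numConflict G σ - conflict G σ v := by
  refine (Finset.sum_le_sum fun u _ => conflict_update_le G σ v u b hb).trans_eq ?_
  simp [Finset.sum_sub_distrib, numConflict]

lemma numConflict_tryOccupy_le (σ : V → Bool) (v : V) :
    numConflict G (tryOccupy G σ v) ≤ numConflict G σ - conflict G σ v :=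
  numConflict_update_le G σ v _ (by simp)

lemma numConflict_vacate_le (σ : V → Bool) (v : V) :
    numConflict G (vacate σ v) ≤ numConflict G σ - conflict G σ v :=
  numConflict_update_le G σ v _ (by simp)

lemma sum_blockDisagr_vacate_le (σ τ : V → Bool) (y : V) :
    ∑ v, (blockDisagr G (vacate σ v) (vacate τ v) y - blockDisagr G σ τ y) ≤
      ∑ v, ind (G.Adj y v) * disagr σ τ v - 2 * blockDisagr G σ τ y := by
  classical
  let occ : (V → Bool) → Finset V := fun σ => univ.filter fun u => G.Adj y u ∧ σ u = true
  have h1 : ∀ σ, SiteFree G σ y ↔ occ σ = ∅ := by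
    intro σ
    simp [SiteFree, occ, Finset.filter_eq_empty_iff]
  have h2 : ∀ σ v, SiteFree G (vacate σ v) y ↔ (occ σ).erase v = ∅ := by
    intro σ v
    rw [h1]
    have : occ (vacate σ v) = (occ σ).erase v := by
      ext u
      by_cases h : u = v
      · subst h; simp [occ, vacate]
      · simp [occ, vacate, h]
    rw [this]
  have h3 : ((symmDiff (occ σ) (occ τ)).card : ℝ) = ∑ v, ind (G.Adj y v) * disagr σ τ v := by
    have : symmDiff (occ σ) (occ τ) = univ.filter fun u => G.Adj y u ∧ σ u ≠ τ u := by
      ext u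
      simp only [Finset.mem_symmDiff, occ, Finset.mem_filter, Finset.mem_univ, true_and]
      cases σ u <;> cases τ u <;> simp
    rw [this, Finset.card_filter]
    push_cast
    refine Finset.sum_congr rfl fun u _ => ?_
    by_cases ha : G.Adj y u <;> by_cases hu : σ u = τ u <;> simp [ha, hu, disagr]
  simp only [blockDisagr, h2]
  simp only [h1]
  rw [← h3]
  exact sum_erase_empty_le (occ σ) (occ τ)

lemma sum_numBlockDisagr_vacate_le [DecidableRel G.Adj] (σ τ : V → Bool) :
    ∑ v, (numBlockDisagr G (vacate σ v) (vacate τ v) - numBlockDisagr G σ τ) ≤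
      G.maxDegree * numDisagr σ τ - 2 * numBlockDisagr G σ τ := by
  simp only [numBlockDisagr, ← Finset.sum_sub_distrib]
  rw [Finset.sum_comm]
  refine (Finset.sum_le_sum fun y _ => sum_blockDisagr_vacate_le G σ τ y).trans ?_
  rw [Finset.sum_sub_distrib, ← Finset.mul_sum, Finset.sum_comm]
  gcongr
  exact sum_sum_adj_mul_le G _ fun v => ind_nonneg _

lemma sum_numBlockDisagr_tryOccupy_le [DecidableRel G.Adj] (σ τ : V → Bool) :
    ∑ v, (numBlockDisagr G (tryOccupy G σ v) (tryOccupy G τ v) - numBlockDisagr G σ τ) ≤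
      G.maxDegree * (numConflict G σ + numConflict G τ) := by
  simp only [numBlockDisagr, ← Finset.sum_sub_distrib]
  refine (Finset.sum_le_sum fun v _ => Finset.sum_le_sum fun y _ =>
    blockDisagr_tryOccupy_le G σ τ y v).trans ?_
  have key : ∀ v y, ind (G.Adj y v) * (bothFree G σ τ y * blockDisagr G σ τ v -
        blockDisagr G σ τ y * bothFree G σ τ v + conflict G σ v + conflict G τ v) =
      ind (G.Adj y v) * (conflict G σ v + conflict G τ v) +
        (ind (G.Adj y v) * (bothFree G σ τ y * blockDisagr G σ τ v) -
          ind (G.Adj y v) * (blockDisagr G σ τ y * bothFree G σ τ v)) := fun v y => by ring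
  simp only [key, Finset.sum_add_distrib, Finset.sum_sub_distrib]
  have swap : ∑ v, ∑ y, ind (G.Adj y v) * (bothFree G σ τ y * blockDisagr G σ τ v) =
      ∑ v, ∑ y, ind (G.Adj y v) * (blockDisagr G σ τ y * bothFree G σ τ v) := by
    rw [Finset.sum_comm]
    refine Finset.sum_congr rfl fun v _ => Finset.sum_congr rfl fun y _ => ?_
    rw [G.adj_comm, mul_comm (bothFree G σ τ v)]
  rw [swap, sub_self, add_zero, numConflict, numConflict, ← Finset.sum_add_distrib]
  exact sum_sum_adj_mul_le G _ fun v => add_nonneg (ind_nonneg _) (ind_nonneg _)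

/-- The potential contracts on average under a uniformly random single-site update. -/
lemma sum_potential_step_le [DecidableRel G.Adj] {p q c β : ℝ} (hp : 0 ≤ p) (hq : 0 ≤ q)
    (hpq : p + q = 1) (hc : 0 ≤ c) (h1 : c * q * G.maxDegree ≤ 1 - β) (h2 : β * c ≤ 2 * c * q - p)
    (h3 : c * p * G.maxDegree ≤ 3 * (1 - β)) (σ τ : V → Bool) :
    ∑ v, (p * potential G c (tryOccupy G σ v) (tryOccupy G τ v) +
        q * potential G c (vacate σ v) (vacate τ v)) ≤
      (Fintype.card V - β) * potential G c σ τ := by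
  have hD := numDisagr_nonneg σ τ
  have hB := numBlockDisagr_nonneg G σ τ
  have hM := add_nonneg (numConflict_nonneg G σ) (numConflict_nonneg G τ)
  have hV := mul_le_mul_of_nonneg_left (sum_numBlockDisagr_vacate_le G σ τ) (mul_nonneg hc hq)
  have hT := mul_le_mul_of_nonneg_left (sum_numBlockDisagr_tryOccupy_le G σ τ) (mul_nonneg hc hp)
  have hpt : ∀ v, p * potential G c (tryOccupy G σ v) (tryOccupy G τ v) +
        q * potential G c (vacate σ v) (vacate τ v) ≤
      potential G c σ τ + (p * blockDisagr G σ τ v - disagr σ τ v) +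
      (c * p * (numBlockDisagr G (tryOccupy G σ v) (tryOccupy G τ v) - numBlockDisagr G σ τ)) +
      (c * q * (numBlockDisagr G (vacate σ v) (vacate τ v) - numBlockDisagr G σ τ)) -
      3 * (conflict G σ v + conflict G τ v) := by
    intro v
    have a1 := mul_le_mul_of_nonneg_left (add_le_add (numConflict_tryOccupy_le G σ v)
      (numConflict_tryOccupy_le G τ v)) hp
    have a2 := mul_le_mul_of_nonneg_left (add_le_add (numConflict_vacate_le G σ v)
      (numConflict_vacate_le G τ v)) hq
    obtain rfl : q = 1 - p := by linarith
    simp only [potential, numDisagr_tryOccupy, numDisagr_vacate]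
    linarith
  refine (Finset.sum_le_sum fun v _ => hpt v).trans ?_
  simp only [Finset.sum_sub_distrib, Finset.sum_add_distrib, ← Finset.mul_sum] at hV hT ⊢
  simp only [Finset.sum_const, Finset.card_univ, nsmul_eq_mul] at hV hT ⊢
  have e1 : ∑ v, disagr σ τ v = numDisagr σ τ := rfl
  have e2 : ∑ v, blockDisagr G σ τ v = numBlockDisagr G σ τ := rfl
  have e3 : ∑ v, conflict G σ v = numConflict G σ := rfl
  have e4 : ∑ v, conflict G τ v = numConflict G τ := rfl
  rw [e1, e2, e3, e4]
  have b1 := mul_le_mul_of_nonneg_right h1 hD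
  have b2 := mul_le_mul_of_nonneg_right h2 hB
  have b3 := mul_le_mul_of_nonneg_right h3 hM
  unfold potential
  linarith

end Drift

section Chain

/-- Dual form of the coupling bound: a kernel contracting Lipschitz functions for `d` brings the
chain close to its stationary distribution on every Lipschitz test function. -/
lemma chainDist_sub_le {S : Type*} [Fintype S] [DecidableEq S] {P : S → S → ℝ} {π : S → ℝ}
    {d : S → S → ℝ} {r C : ℝ} (hr : 0 ≤ r) (hd : ∀ s t, d s t ≤ C)
    (hπ : ∀ s, 0 ≤ π s) (hπ1 : ∑ s, π s = 1) (hst : ∀ x, ∑ s, π s * P s x = π x)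
    (hP : ∀ (f : S → ℝ) (L : ℝ), 0 ≤ L → (∀ s t, f s - f t ≤ L * d s t) →
      ∀ s t, ∑ x, P s x * f x - ∑ x, P t x * f x ≤ L * r * d s t)
    (s0 : S) (n : ℕ) : ∀ (f : S → ℝ) (L : ℝ), 0 ≤ L → (∀ s t, f s - f t ≤ L * d s t) →
      ∑ x, chainDist P (initDelta s0) n x * f x - ∑ x, π x * f x ≤ L * r ^ n * C := by
  induction n with
  | zero =>
    intro f L hL hf
    have e : f s0 - ∑ x, π x * f x = ∑ x, π x * (f s0 - f x) := by
      simp [mul_sub, Finset.sum_sub_distrib, ← Finset.sum_mul, hπ1]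
    simp only [chainDist, initDelta, ite_mul, one_mul, zero_mul, Finset.sum_ite_eq',
      Finset.mem_univ, if_true, pow_zero, mul_one, e]
    calc ∑ x, π x * (f s0 - f x) ≤ ∑ x, π x * (L * C) :=
          Finset.sum_le_sum fun x _ => mul_le_mul_of_nonneg_left
            ((hf s0 x).trans (mul_le_mul_of_nonneg_left (hd s0 x) hL)) (hπ x)
      _ = L * C := by rw [← Finset.sum_mul, hπ1, one_mul]
  | succ n ih =>
    intro f L hL hf
    have e1 : ∑ x, chainDist P (initDelta s0) (n + 1) x * f x =
        ∑ s, chainDist P (initDelta s0) n s * ∑ x, P s x * f x := by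
      simp only [chainDist, Finset.sum_mul, Finset.mul_sum]
      rw [Finset.sum_comm]
      simp only [mul_assoc]
    have e2 : ∑ x, π x * f x = ∑ s, π s * ∑ x, P s x * f x := by
      simp only [Finset.mul_sum]
      rw [Finset.sum_comm]
      refine Finset.sum_congr rfl fun x _ => ?_
      rw [← hst x, Finset.sum_mul]
      simp only [mul_assoc]
    rw [e1, e2]
    refine (ih _ (L * r) (mul_nonneg hL hr) (hP f L hL hf)).trans_eq ?_
    ring

lemma sum_chainDist {S : Type*} [Fintype S] [DecidableEq S] {P : S → S → ℝ}
    (hP1 : ∀ s, ∑ x, P s x = 1) (s0 : S) (n : ℕ) :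
    ∑ x, chainDist P (initDelta s0) n x = 1 := by
  induction n with
  | zero => simp [chainDist, initDelta]
  | succ n ih =>
    simp only [chainDist]
    rw [Finset.sum_comm]
    simp [← Finset.mul_sum, hP1, ih]

lemma tvDist_chainDist_le {S : Type*} [Fintype S] [DecidableEq S] {P : S → S → ℝ} {π : S → ℝ}
    {d : S → S → ℝ} {r C : ℝ} (hr : 0 ≤ r) (hd : ∀ s t, d s t ≤ C)
    (hd0 : ∀ s t, 0 ≤ d s t) (hd1 : ∀ s t, s ≠ t → 1 ≤ d s t)
    (hπ : ∀ s, 0 ≤ π s) (hπ1 : ∑ s, π s = 1) (hst : ∀ x, ∑ s, π s * P s x = π x)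
    (hP1 : ∀ s, ∑ x, P s x = 1)
    (hP : ∀ (f : S → ℝ) (L : ℝ), 0 ≤ L → (∀ s t, f s - f t ≤ L * d s t) →
      ∀ s t, ∑ x, P s x * f x - ∑ x, P t x * f x ≤ L * r * d s t)
    (s0 : S) (n : ℕ) : tvDist (chainDist P (initDelta s0) n) π ≤ r ^ n * C := by
  have h1 := sum_chainDist hP1 s0 n
  generalize hμ : chainDist P (initDelta s0) n = μ at *
  have key := chainDist_sub_le hr hd hπ hπ1 hst hP s0 n (fun x => ind (π x < μ x)) 1 zero_le_one
    (fun s t => by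
      by_cases h : s = t
      · subst h; simpa using hd0 s s
      · have := hd1 s t h
        have := ind_nonneg (π t < μ t)
        have := ind_le_one (π s < μ s)
        simp only [one_mul]
        linarith)
  rw [hμ, one_mul] at key
  refine le_trans (le_of_eq ?_) key
  have e : ∀ x, |μ x - π x| = 2 * (μ x * ind (π x < μ x) - π x * ind (π x < μ x)) -
      (μ x - π x) := by
    intro x
    by_cases h : π x < μ x
    · rw [abs_of_pos (by linarith)]; simp only [h, ind_true]; ring
    · rw [abs_of_nonpos (by linarith)]; simp [h]
  simp only [tvDist, e, Finset.sum_sub_distrib, ← Finset.mul_sum, h1, hπ1]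
  ring

end Chain

section Weight

lemma isIndep_empty {V : Type*} (G : SimpleGraph V) : IsIndep G fun _ => false :=
  fun u v _ => by simp

lemma isIndep_update_true_iff {V : Type*} [DecidableEq V] (G : SimpleGraph V) {σ : V → Bool} {v : V}
    (f : SiteFree G σ v) : IsIndep G (Function.update σ v true) ↔ IsIndep G σ := by
  constructor
  · rintro h a b hab ⟨ha, hb⟩
    refine h a b hab ⟨?_, ?_⟩
    · by_cases hav : a = v <;> simp [hav, ha]
    · by_cases hbv : b = v <;> simp [hbv, hb]
  · rintro h a b hab ⟨ha, hb⟩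
    by_cases hav : a = v
    · subst hav
      rw [Function.update_of_ne hab.ne', f b hab] at hb
      simp at hb
    · rw [Function.update_of_ne hav] at ha
      by_cases hbv : b = v
      · subst hbv
        rw [f a hab.symm] at ha
        simp at ha
      · rw [Function.update_of_ne hbv] at hb
        exact h a b hab ⟨ha, hb⟩

variable {V : Type*} [Fintype V] (G : SimpleGraph V) {lam : ℝ}

lemma hcWeight_nonneg (hl : 0 < lam) (σ : V → Bool) : 0 ≤ hcWeight G lam σ := by
  unfold hcWeight; split_ifs <;> positivity

variable [DecidableEq V]

lemma sum_hcWeight_pos (hl : 0 < lam) : 0 < ∑ σ, hcWeight G lam σ := by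
  refine Finset.sum_pos' (fun σ _ => hcWeight_nonneg G hl σ) ⟨fun _ => false, mem_univ _, ?_⟩
  simp [hcWeight, isIndep_empty G]

lemma hcGibbs_nonneg (hl : 0 < lam) (σ : V → Bool) : 0 ≤ hcGibbs G lam σ :=
  div_nonneg (hcWeight_nonneg G hl σ) (sum_hcWeight_pos G hl).le

lemma sum_hcGibbs (hl : 0 < lam) : ∑ σ, hcGibbs G lam σ = 1 := by
  simp only [hcGibbs, ← Finset.sum_div]
  exact div_self (sum_hcWeight_pos G hl).ne'

end Weight

section Gibbs

variable {V : Type*} [Fintype V] (G : SimpleGraph V) [DecidableRel G.Adj] {lam : ℝ}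

lemma margHC_true (v : V) (τ : V → Bool) :
    margHC G lam v τ true = ind (SiteFree G τ v) * (lam / (1 + lam)) := by
  by_cases h : SiteFree G τ v
  · have h' : ∀ u ∈ G.neighborFinset v, τ u = false := by simpa [SiteFree] using h
    simp only [margHC, if_pos h', h, ind_true, if_true, one_mul]
  · have h' : ¬ ∀ u ∈ G.neighborFinset v, τ u = false := by simpa [SiteFree] using h
    simp only [margHC, if_neg h', h, ind_false, if_true, zero_mul, zero_div]

lemma margHC_false (hl : 0 < lam) (v : V) (τ : V → Bool) :
    margHC G lam v τ false = 1 - ind (SiteFree G τ v) * (lam / (1 + lam)) := by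
  have : 1 + lam ≠ 0 := by positivity
  by_cases h : SiteFree G τ v
  · have h' : ∀ u ∈ G.neighborFinset v, τ u = false := by simpa [SiteFree] using h
    simp only [margHC, if_pos h', h, ind_true, one_mul, Bool.false_eq_true, if_false]
    field_simp
    ring
  · have h' : ¬ ∀ u ∈ G.neighborFinset v, τ u = false := by simpa [SiteFree] using h
    simp only [margHC, if_neg h', h, ind_false, Bool.false_eq_true, if_false]
    norm_num

variable [DecidableEq V]

lemma sum_optimalCoupling (hl : 0 < lam) {σ τ : V → Bool} {v : V} {D : Bool → Bool → ℝ}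
    (hD : IsOptimalCoupling (margHC G lam v σ) (margHC G lam v τ) D)
    (ρ : (V → Bool) → (V → Bool) → ℝ) :
    ∑ b, ∑ b', D b b' * ρ (Function.update σ v b) (Function.update τ v b') =
      lam / (1 + lam) * ρ (tryOccupy G σ v) (tryOccupy G τ v) +
        (1 - lam / (1 + lam)) * ρ (vacate σ v) (vacate τ v) := by
  obtain ⟨⟨h0, hr, hc⟩, hopt⟩ := hD
  have r1 := hr true
  have r2 := hr false
  have c1 := hc true
  have c2 := hc false
  have hp0 : 0 ≤ lam / (1 + lam) := by positivity
  have hp1 : lam / (1 + lam) ≤ 1 := by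
    rw [div_le_one (by positivity)]; linarith
  have mt := margHC_true G (lam := lam) v
  have mf := margHC_false G hl v
  rw [mt] at r1 c1
  rw [mf] at r2 c2
  simp only [Fintype.sum_bool] at r1 r2 c1 c2 hopt ⊢
  generalize lam / (1 + lam) = p at *
  have n1 := h0 true true
  have n2 := h0 true false
  have n3 := h0 false true
  have n4 := h0 false false
  by_cases f : SiteFree G σ v <;> by_cases f' : SiteFree G τ v <;>
    simp only [f, f', ind_true, ind_false, one_mul, zero_mul, sub_zero] at r1 r2 c1 c2 <;>
    simp only [tryOccupy, vacate, f, f', decide_true, decide_false]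
  · have := hopt (fun b b' => if b = b' then (if b then p else 1 - p) else 0) (by
      refine ⟨?_, ?_, ?_⟩
      · intro b b'
        cases b <;> cases b' <;> simp <;> linarith
      · intro b
        cases b <;> simp [mt, mf, f]
      · intro b
        cases b <;> simp [mt, mf, f'])
    simp at this
    have z1 : D true false = 0 := by linarith
    have z2 : D false true = 0 := by linarith
    have z3 : D true true = p := by linarith
    have z4 : D false false = 1 - p := by linarith
    rw [z1, z2, z3, z4]; ring
  · have z1 : D true true = 0 := by linarith
    have z2 : D false true = 0 := by linarith
    have z3 : D true false = p := by linarith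
    have z4 : D false false = 1 - p := by linarith
    rw [z1, z2, z3, z4]; ring
  · have z1 : D true true = 0 := by linarith
    have z2 : D true false = 0 := by linarith
    have z3 : D false true = p := by linarith
    have z4 : D false false = 1 - p := by linarith
    rw [z1, z2, z3, z4]; ring
  · have z1 : D true true = 0 := by linarith
    have z2 : D true false = 0 := by linarith
    have z3 : D false true = 0 := by linarith
    have z4 : D false false = 1 := by linarith
    rw [z1, z2, z3, z4]; ring

lemma sum_update_kernel (σ : V → Bool) (v : V) (m : Bool → ℝ) (f : (V → Bool) → ℝ) :
    ∑ σ' : V → Bool, ind (∀ u, u ≠ v → σ' u = σ u) * m (σ' v) * f σ' =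
      m true * f (Function.update σ v true) + m false * f (Function.update σ v false) := by
  have e : ∀ b, m b * f (Function.update σ v b) =
      ∑ σ' : V → Bool, ind (σ' = Function.update σ v b) * (m b * f σ') := by
    intro b
    rw [Finset.sum_eq_single (Function.update σ v b)]
    · simp
    · intro σ' _ h; simp [h]
    · simp
  rw [e, e, ← Finset.sum_add_distrib]
  refine Finset.sum_congr rfl fun σ' _ => ?_
  have iff : ∀ b, σ' = Function.update σ v b ↔ σ' v = b ∧ ∀ u, u ≠ v → σ' u = σ u := fun b =>
    Function.eq_update_iff
  simp only [iff]
  by_cases h : ∀ u, u ≠ v → σ' u = σ u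
  · cases hb : σ' v <;> simp [ind_of h]
  · simp only [h, and_false, ind_false]; ring

lemma gibbsStepHC_eq (σ σ' : V → Bool) : gibbsStepHC G lam σ σ' = (Fintype.card V : ℝ)⁻¹ *
    ∑ v, ind (∀ u, u ≠ v → σ' u = σ u) * margHC G lam v σ (σ' v) := by
  unfold gibbsStepHC
  congr 1
  refine Finset.sum_congr rfl fun v _ => ?_
  by_cases h : ∀ u, u ≠ v → σ' u = σ u
  · rw [if_pos h, ind_of h, one_mul]
  · rw [if_neg h, ind_of_not h, zero_mul]

lemma sum_gibbsStepHC_mul (hl : 0 < lam) (σ : V → Bool) (f : (V → Bool) → ℝ) :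
    ∑ σ', gibbsStepHC G lam σ σ' * f σ' = (Fintype.card V : ℝ)⁻¹ *
      ∑ v, (lam / (1 + lam) * f (tryOccupy G σ v) + (1 - lam / (1 + lam)) * f (vacate σ v)) := by
  simp only [gibbsStepHC_eq, mul_assoc, ← Finset.mul_sum, Finset.sum_mul]
  congr 1
  rw [Finset.sum_comm]
  refine Finset.sum_congr rfl fun v _ => ?_
  simp only [← mul_assoc]
  rw [sum_update_kernel, margHC_true G, margHC_false G hl]
  by_cases h : SiteFree G σ v <;> simp [h, tryOccupy, vacate]; try ring

lemma sum_gibbsStepHC [Nonempty V] (hl : 0 < lam) (σ : V → Bool) :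
    ∑ σ', gibbsStepHC G lam σ σ' = 1 := by
  simpa using sum_gibbsStepHC_mul G hl σ fun _ => 1

lemma hcWeight_mul_margHC (hl : 0 < lam) {σ : V → Bool} {v : V} (hσ : σ v = false) :
    hcWeight G lam σ * margHC G lam v σ true =
      hcWeight G lam (Function.update σ v true) *
        margHC G lam v (Function.update σ v true) false := by
  have hf : SiteFree G (Function.update σ v true) v ↔ SiteFree G σ v :=
    siteFree_update_of_not_adj G G.irrefl true
  rw [margHC_true G, margHC_false G hl]
  simp only [hf]
  by_cases f : SiteFree G σ v
  · have hi := isIndep_update_true_iff G f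
    have hcard : (univ.filter fun u => Function.update σ v true u = true).card =
        (univ.filter fun u => σ u = true).card + 1 := by
      have : (univ.filter fun u => Function.update σ v true u = true) =
          insert v (univ.filter fun u => σ u = true) := by
        ext u
        by_cases h : u = v
        · subst h; simp
        · simp [h]
      rw [this, Finset.card_insert_of_notMem (by simp [hσ])]
    have : 1 + lam ≠ 0 := by positivity
    by_cases h : IsIndep G σ
    · simp only [hcWeight, hi, h, if_true, f, ind_true, one_mul]
      rw [show (Finset.filter (fun u => Function.update σ v true u = true) univ).card = _
        from hcard, pow_succ]
      field_simp
      ring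
    · simp [hcWeight, hi, h]
  · have : ¬ IsIndep G (Function.update σ v true) := by
      intro h
      refine f fun u hu => ?_
      have := h v u hu
      rw [Function.update_of_ne hu.ne'] at this
      simpa using this
    simp [hcWeight, this, f]

lemma hcWeight_mul_gibbsStepHC (hl : 0 < lam) (σ σ' : V → Bool) :
    hcWeight G lam σ * gibbsStepHC G lam σ σ' = hcWeight G lam σ' * gibbsStepHC G lam σ' σ := by
  simp only [gibbsStepHC_eq, mul_left_comm _ (Fintype.card V : ℝ)⁻¹, Finset.mul_sum]
  refine Finset.sum_congr rfl fun v _ => ?_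
  congr 1
  have e : (∀ u, u ≠ v → σ u = σ' u) ↔ ∀ u, u ≠ v → σ' u = σ u := by simp only [eq_comm]
  rw [e]
  by_cases h : ∀ u, u ≠ v → σ' u = σ u
  swap
  · simp [ind_of_not h]
  rw [ind_of h, one_mul, one_mul]
  have h' : ∀ b, σ' v = b → σ' = Function.update σ v b := fun b hb =>
    Function.eq_update_iff.2 ⟨hb, h⟩
  have h'' : ∀ b, σ v = b → σ = Function.update σ' v b := fun b hb =>
    Function.eq_update_iff.2 ⟨hb, e.2 h⟩
  by_cases hv : σ v = σ' v
  · obtain rfl : σ' = σ := by rw [h' _ hv.symm, Function.update_eq_self]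
    rfl
  · cases hb : σ v <;> cases hb' : σ' v <;> try simp [hb, hb'] at hv
    · rw [h' _ hb']; exact hcWeight_mul_margHC G hl hb
    · conv_rhs => rw [hcWeight_mul_margHC G hl hb']
      rw [← h'' _ hb]

lemma hcGibbs_stationary [Nonempty V] (hl : 0 < lam) (σ' : V → Bool) :
    ∑ σ, hcGibbs G lam σ * gibbsStepHC G lam σ σ' = hcGibbs G lam σ' := by
  simp only [hcGibbs, div_mul_eq_mul_div, ← Finset.sum_div, hcWeight_mul_gibbsStepHC G hl _ σ']
  rw [← Finset.mul_sum, sum_gibbsStepHC G hl, mul_one]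

end Gibbs

section FeasiblePotential

variable {V : Type*} [Fintype V] (G : SimpleGraph V)

lemma numDisagr_self (σ : V → Bool) : numDisagr σ σ = 0 := by simp [numDisagr, disagr]

lemma numBlockDisagr_self (σ : V → Bool) : numBlockDisagr G σ σ = 0 := by
  simp [numBlockDisagr, blockDisagr]

lemma one_le_numDisagr {σ τ : V → Bool} (h : σ ≠ τ) : 1 ≤ numDisagr σ τ := by
  obtain ⟨v, hv⟩ := Function.ne_iff.1 h
  have := Finset.single_le_sum (f := disagr σ τ) (fun u _ => ind_nonneg _) (mem_univ v)
  rwa [disagr, ind_of hv] at this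

lemma abs_ind_sub_ind_le (a b a' b' : Prop) :
    |ind (¬ (a ↔ b)) - ind (¬ (a' ↔ b'))| ≤ ind (¬ (a ↔ a')) + ind (¬ (b ↔ b')) := by
  by_cases a <;> by_cases b <;> by_cases a' <;> by_cases b' <;> simp [*]

lemma abs_numBlockDisagr_sub_le (σ τ σ' τ' : V → Bool) :
    |numBlockDisagr G σ τ - numBlockDisagr G σ' τ'| ≤
      numBlockDisagr G σ σ' + numBlockDisagr G τ τ' := by
  simp only [numBlockDisagr, ← Finset.sum_sub_distrib, ← Finset.sum_add_distrib]
  exact (Finset.abs_sum_le_sum_abs _ _).trans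
    (Finset.sum_le_sum fun v _ => abs_ind_sub_ind_le _ _ _ _)

lemma abs_numDisagr_sub_le (σ τ σ' τ' : V → Bool) :
    |numDisagr σ τ - numDisagr σ' τ'| ≤ numDisagr σ σ' + numDisagr τ τ' := by
  simp only [numDisagr, ← Finset.sum_sub_distrib, ← Finset.sum_add_distrib]
  refine (Finset.abs_sum_le_sum_abs _ _).trans (Finset.sum_le_sum fun v _ => ?_)
  have e : ∀ σ τ : V → Bool, disagr σ τ v = ind (¬ (σ v = true ↔ τ v = true)) :=
    fun σ τ => by rw [disagr, ne_eq, Bool.eq_iff_iff]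
  simp only [e]
  exact abs_ind_sub_ind_le _ _ _ _

lemma blockDisagr_le (σ τ : V → Bool) (y : V) :
    blockDisagr G σ τ y ≤ ∑ v, ind (G.Adj y v) * disagr σ τ v := by
  have h0 : ∀ v, 0 ≤ ind (G.Adj y v) * disagr σ τ v :=
    fun v => mul_nonneg (ind_nonneg _) (ind_nonneg _)
  by_cases h : SiteFree G σ y ↔ SiteFree G τ y
  · rw [blockDisagr, ind_of_not (not_not.2 h)]
    exact Finset.sum_nonneg fun v _ => h0 v
  · rw [blockDisagr, ind_of h]
    have : ∃ v, G.Adj y v ∧ σ v ≠ τ v := by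
      by_contra! H
      exact h (forall_congr' fun u => imp_congr_right fun hu => by rw [H u hu])
    obtain ⟨v, hv, hne⟩ := this
    refine le_trans ?_ (Finset.single_le_sum (fun u _ => h0 u) (mem_univ v))
    rw [disagr, ind_of hv, ind_of hne, one_mul]

lemma numBlockDisagr_le [DecidableRel G.Adj] (σ τ : V → Bool) :
    numBlockDisagr G σ τ ≤ G.maxDegree * numDisagr σ τ := by
  refine (Finset.sum_le_sum fun y _ => blockDisagr_le G σ τ y).trans ?_
  rw [Finset.sum_comm]
  exact sum_sum_adj_mul_le G _ fun v => ind_nonneg _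

lemma potential_nonneg {c : ℝ} (hc : 0 ≤ c) (σ τ : V → Bool) : 0 ≤ potential G c σ τ := by
  have := numDisagr_nonneg σ τ
  have := numBlockDisagr_nonneg G σ τ
  have := numConflict_nonneg G σ
  have := numConflict_nonneg G τ
  unfold potential
  positivity

lemma numDisagr_add_le_potential (c : ℝ) (σ τ : V → Bool) :
    numDisagr σ τ + c * numBlockDisagr G σ τ ≤ potential G c σ τ := by
  have := numConflict_nonneg G σ
  have := numConflict_nonneg G τ
  unfold potential
  linarith

lemma potential_of_isIndep (c : ℝ) {σ τ : V → Bool} (hσ : IsIndep G σ) (hτ : IsIndep G τ) :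
    potential G c σ τ = numDisagr σ τ + c * numBlockDisagr G σ τ := by
  simp [potential, numConflict_eq_zero G hσ, numConflict_eq_zero G hτ]

lemma potential_le {c : ℝ} (hc : c ≤ 1) (σ τ : V → Bool) :
    potential G c σ τ ≤ 8 * Fintype.card V := by
  have h1 : numDisagr σ τ ≤ Fintype.card V := sum_ind_le_card _
  have h2 : numBlockDisagr G σ τ ≤ Fintype.card V := sum_ind_le_card _
  have h3 : numConflict G σ ≤ Fintype.card V := sum_ind_le_card _
  have h4 : numConflict G τ ≤ Fintype.card V := sum_ind_le_card _
  have h5 := mul_le_mul_of_nonneg_right hc (numBlockDisagr_nonneg G σ τ)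
  unfold potential
  linarith

/-- A maximum independent set dominates, and has size at least `n / (Δ + 1)`. -/
lemma exists_isIndep_dominating [DecidableRel G.Adj] :
    ∃ σ : V → Bool, IsIndep G σ ∧
      Fintype.card V ≤ (G.maxDegree + 1) * numDisagr (fun _ => false) σ ∧
      Fintype.card V ≤ numDisagr (fun _ => false) σ +
        numBlockDisagr G (fun _ => false) σ := by
  classical
  obtain ⟨σ, hσ, hmax⟩ := Finset.exists_max_image (univ.filter fun σ : V → Bool => IsIndep G σ)
    (fun σ => numDisagr (fun _ => false) σ) ⟨_, by simpa using isIndep_empty G⟩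
  simp only [Finset.mem_filter, Finset.mem_univ, true_and] at hσ hmax
  have dom : ∀ v, σ v = false → ¬ SiteFree G σ v := by
    intro v hv hf
    have := hmax _ ((isIndep_update_true_iff G hf).2 hσ)
    have e : (fun _ : V => false) = Function.update (fun _ => false) v false := by simp
    rw [e, numDisagr_update, ← e] at this
    norm_num [disagr, hv] at this
  have pt : ∀ v, 1 ≤ disagr (fun _ => false) σ v + blockDisagr G (fun _ => false) σ v := by
    intro v
    cases hv : σ v
    · have : SiteFree G (fun _ => false) v := fun _ _ => rfl
      simp [disagr, blockDisagr, hv, dom v hv, this]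
    · rw [disagr, ind_of (by simp [hv])]
      exact le_add_of_nonneg_right (ind_nonneg _)
  have hsum := Finset.sum_le_sum fun v (_ : v ∈ univ) => pt v
  simp only [Finset.sum_add_distrib, Finset.sum_const, Finset.card_univ, nsmul_eq_mul,
    mul_one] at hsum
  refine ⟨σ, hσ, ?_, hsum⟩
  have := numBlockDisagr_le G (fun _ => false) σ
  unfold numBlockDisagr at this
  change _ ≤ numDisagr _ _ + _ at hsum
  linarith

/-- The potential on feasible pairs, scaled so that its diameter is at most `Δ n`. -/
noncomputable def scaledPotential (K c : ℝ) (σ τ : V → Bool) : ℝ :=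
  K * (numDisagr σ τ + c * numBlockDisagr G σ τ)

lemma scaledPotential_self (K c : ℝ) (σ : V → Bool) : scaledPotential G K c σ σ = 0 := by
  simp [scaledPotential, numDisagr_self, numBlockDisagr_self]

lemma numDisagr_le_scaledPotential {K c : ℝ} (hK : 1 ≤ K) (hc : 0 ≤ c) (σ τ : V → Bool) :
    numDisagr σ τ ≤ scaledPotential G K c σ τ := by
  have h1 := mul_nonneg hc (numBlockDisagr_nonneg G σ τ)
  have h2 := numDisagr_nonneg σ τ
  calc numDisagr σ τ ≤ 1 * (numDisagr σ τ + c * numBlockDisagr G σ τ) := by linarith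
    _ ≤ _ := mul_le_mul_of_nonneg_right hK (add_nonneg h2 h1)

lemma scaledPotential_le_mul_potential {K : ℝ} (hK : 0 ≤ K) (c : ℝ) (σ τ : V → Bool) :
    scaledPotential G K c σ τ ≤ K * potential G c σ τ :=
  mul_le_mul_of_nonneg_left (numDisagr_add_le_potential G c σ τ) hK

lemma scaledPotential_of_isIndep (K c : ℝ) {σ τ : V → Bool} (hσ : IsIndep G σ)
    (hτ : IsIndep G τ) : scaledPotential G K c σ τ = K * potential G c σ τ := by
  rw [scaledPotential, potential_of_isIndep G c hσ hτ]

lemma scaledPotential_le {K c : ℝ} (hK : 0 ≤ K) (hc : 0 ≤ c) (σ τ : V → Bool) :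
    scaledPotential G K c σ τ ≤ K * (1 + c) * Fintype.card V := by
  have h1 : numDisagr σ τ ≤ Fintype.card V := sum_ind_le_card _
  have h2 : numBlockDisagr G σ τ ≤ Fintype.card V := sum_ind_le_card _
  have h3 := mul_le_mul_of_nonneg_left h2 hc
  calc scaledPotential G K c σ τ ≤ K * (Fintype.card V + c * Fintype.card V) :=
        mul_le_mul_of_nonneg_left (by linarith) hK
    _ = _ := by ring

/-- The diameter of the feasible space is linear in the number of sites. -/
lemma exists_isIndep_le_scaledPotential [DecidableRel G.Adj] {K c : ℝ} (hc0 : 0 ≤ c)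
    (hc1 : c ≤ 1) (hΔ : 3 ≤ (G.maxDegree : ℝ)) (hK : K * (1 + c) = G.maxDegree) :
    ∃ σ : V → Bool, IsIndep G σ ∧
      3 / 4 * (Fintype.card V : ℝ) ≤ scaledPotential G K c (fun _ => false) σ := by
  obtain ⟨σ, hσ, h1, h2⟩ := exists_isIndep_dominating G
  refine ⟨σ, hσ, ?_⟩
  have h8 : 0 ≤ numDisagr (fun _ => false) σ + c * numBlockDisagr G (fun _ => false) σ :=
    add_nonneg (numDisagr_nonneg _ _) (mul_nonneg hc0 (numBlockDisagr_nonneg G _ _))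
  have hn : (0 : ℝ) ≤ Fintype.card V := Nat.cast_nonneg _
  unfold scaledPotential
  generalize numDisagr (fun _ => false) σ = α at *
  generalize numBlockDisagr G (fun _ => false) σ = B at *
  generalize (Fintype.card V : ℝ) = n at *
  generalize (G.maxDegree : ℝ) = D at *
  have h3 : (1 - c) * n ≤ (1 - c) * ((D + 1) * α) :=
    mul_le_mul_of_nonneg_left h1 (by linarith)
  have h4 : c * (D + 1) * n ≤ c * (D + 1) * (α + B) :=
    mul_le_mul_of_nonneg_left h2 (mul_nonneg hc0 (by linarith))
  have h5 : 1 * (c * n) ≤ D * (c * n) :=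
    mul_le_mul_of_nonneg_right (by linarith) (mul_nonneg hc0 hn)
  have h7 : 3 / 4 * (D + 1) * (α + c * B) ≤ D * (α + c * B) :=
    mul_le_mul_of_nonneg_right (by linarith) h8
  refine le_of_mul_le_mul_right ?_ (show 0 < 1 + c by linarith)
  calc 3 / 4 * n * (1 + c) ≤ D * (α + c * B) := by linarith
    _ = K * (α + c * B) * (1 + c) := by rw [← hK]; ring

/-- The scaled potential is Lipschitz in its arguments. -/
lemma abs_scaledPotential_sub_le [DecidableRel G.Adj] {K c : ℝ} (hc0 : 0 ≤ c) (hK : 0 ≤ K)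
    (hKΔ : K ≤ G.maxDegree) (hcΔ : c * G.maxDegree ≤ 3) (σ σ' τ τ' : V → Bool) :
    |scaledPotential G K c σ τ - scaledPotential G K c σ' τ'| ≤
      12 * G.maxDegree * (numDisagr σ σ' + numDisagr τ τ') := by
  have h1 := abs_numDisagr_sub_le σ τ σ' τ'
  have h2 := abs_numBlockDisagr_sub_le G σ τ σ' τ'
  have h3 := numBlockDisagr_le G σ σ'
  have h4 := numBlockDisagr_le G τ τ'
  have h5 : 0 ≤ numDisagr σ σ' + numDisagr τ τ' :=
    add_nonneg (numDisagr_nonneg _ _) (numDisagr_nonneg _ _)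
  have e : scaledPotential G K c σ τ - scaledPotential G K c σ' τ' =
      K * ((numDisagr σ τ - numDisagr σ' τ') +
        c * (numBlockDisagr G σ τ - numBlockDisagr G σ' τ')) := by
    simp only [scaledPotential]
    ring
  rw [e, abs_mul, abs_of_nonneg hK]
  have h6 : |(numDisagr σ τ - numDisagr σ' τ') +
      c * (numBlockDisagr G σ τ - numBlockDisagr G σ' τ')| ≤
      4 * (numDisagr σ σ' + numDisagr τ τ') := by
    refine (abs_add_le _ _).trans ?_
    rw [abs_mul, abs_of_nonneg hc0]
    have h7 : c * |numBlockDisagr G σ τ - numBlockDisagr G σ' τ'| ≤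
        c * (G.maxDegree * (numDisagr σ σ' + numDisagr τ τ')) :=
      mul_le_mul_of_nonneg_left (by linarith) hc0
    have h8 := mul_le_mul_of_nonneg_right hcΔ h5
    linarith
  have h9 := mul_nonneg (hK.trans hKΔ) h5
  calc _ ≤ G.maxDegree * (4 * (numDisagr σ σ' + numDisagr τ τ')) :=
        mul_le_mul hKΔ h6 (abs_nonneg _) (hK.trans hKΔ)
    _ ≤ _ := by linarith

end FeasiblePotential

section Parameters

variable {δ lam D : ℝ}

lemma fugacity_mul_le (hD : 3 ≤ D) (hlam : lam ≤ (2 - δ) / (D - 2)) : lam * (D - 2) ≤ 2 - δ := by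
  rwa [le_div_iff₀ (by linarith)] at hlam

lemma fugacity_le (hD : 3 ≤ D) (hlam0 : 0 < lam) (h : lam * (D - 2) ≤ 2 - δ) : lam ≤ 2 - δ := by
  nlinarith

lemma occupation_mul_le (hδ0 : 0 < δ) (hD : 3 ≤ D) (hlam0 : 0 < lam)
    (h : lam * (D - 2) ≤ 2 - δ) : lam / (1 + lam) * D ≤ 2 - δ / 3 := by
  have := fugacity_le hD hlam0 h
  rw [div_mul_eq_mul_div, div_le_iff₀ (by linarith)]
  nlinarith

lemma occupation_ge (hlam0 : 0 < lam) (h : lam ≤ 2) : lam / 3 ≤ lam / (1 + lam) :=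
  div_le_div_of_nonneg_left hlam0.le (by linarith) (by linarith)

lemma fugacity_mul_vacancy (hlam0 : 0 < lam) :
    lam * (1 - lam / (1 + lam)) = lam / (1 + lam) := by
  have : 1 + lam ≠ 0 := by positivity
  field_simp
  ring

/-- The weight of a blocking disagreement relative to a disagreement. -/
noncomputable def blockWeight (δ lam : ℝ) : ℝ := (1 + δ / 12) * lam / 2

lemma blockWeight_nonneg (hδ0 : 0 < δ) (hlam0 : 0 < lam) : 0 ≤ blockWeight δ lam := by
  unfold blockWeight
  positivity

lemma blockWeight_le_one (hδ0 : 0 < δ) (h : lam ≤ 2 - δ) : blockWeight δ lam ≤ 1 := by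
  have := mul_le_mul_of_nonneg_left h (show 0 ≤ 1 + δ / 12 by positivity)
  unfold blockWeight
  linarith [mul_pos hδ0 hδ0]

lemma blockWeight_mul_vacancy (hlam0 : 0 < lam) : blockWeight δ lam * (1 - lam / (1 + lam)) =
    (1 + δ / 12) * (lam / (1 + lam)) / 2 := by
  unfold blockWeight
  linear_combination (1 + δ / 12) / 2 * fugacity_mul_vacancy hlam0

lemma blockWeight_mul_vacancy_mul_le (hδ0 : 0 < δ) (hlam0 : 0 < lam)
    (h : lam / (1 + lam) * D ≤ 2 - δ / 3) :
    blockWeight δ lam * (1 - lam / (1 + lam)) * D ≤ 1 - δ / 24 := by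
  have := mul_le_mul_of_nonneg_left h (show 0 ≤ 1 + δ / 12 by positivity)
  rw [blockWeight_mul_vacancy hlam0]
  linarith [mul_pos hδ0 hδ0]

lemma mul_blockWeight_le (hδ0 : 0 < δ) (hδ1 : δ ≤ 1) (hlam0 : 0 < lam) (h : lam ≤ 2) :
    δ / 24 * blockWeight δ lam ≤
      2 * blockWeight δ lam * (1 - lam / (1 + lam)) - lam / (1 + lam) := by
  have h1 := mul_le_mul_of_nonneg_left (occupation_ge hlam0 h) hδ0.le
  have h2 := mul_le_mul_of_nonneg_right hδ1 (mul_pos hδ0 hlam0).le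
  rw [mul_assoc 2, blockWeight_mul_vacancy hlam0, blockWeight]
  linarith [mul_pos hδ0 hlam0]

lemma mixing_bound {n x ε R β T : ℝ} (t : ℕ) (hn : 4 ≤ n) (hε0 : 0 < ε) (hε1 : ε < 1)
    (hR : 3 / 4 * n ≤ R) (hβ : β / n ≤ 1) (hT : T * β = 4 * n)
    (hβ0 : 0 < β) (ht : T * Real.log (R / ε) ≤ t) (hx : x ≤ 8 * n) :
    (1 - β / n) ^ t * x ≤ ε := by
  have hR0 : 0 < R := by linarith
  have hRε : 0 < R / ε := by positivity
  have h1 : (1 - β / n) ^ t ≤ Real.exp (-(β / n) * t) := by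
    rw [mul_comm, Real.exp_nat_mul]
    exact pow_le_pow_left₀ (by linarith) (by linarith [Real.add_one_le_exp (-(β / n))]) t
  have h2 : Real.exp (-(β / n) * t) ≤ (ε / R) ^ 4 := by
    have e : (ε / R) ^ 4 = Real.exp (-(4 * Real.log (R / ε))) := by
      rw [← Real.exp_log (show 0 < (ε / R) ^ 4 by positivity), Real.log_pow,
        ← inv_div R ε, Real.log_inv]
      congr 1
      push_cast
      ring
    rw [e, Real.exp_le_exp]
    have h3 := mul_le_mul_of_nonneg_left ht (show 0 ≤ β / n by positivity)
    have h4 : β / n * (T * Real.log (R / ε)) = 4 * Real.log (R / ε) := by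
      rw [show β / n * (T * Real.log (R / ε)) = T * β / n * Real.log (R / ε) by ring, hT]
      field_simp
    linarith
  have h0 : 0 ≤ (1 - β / n) ^ t := pow_nonneg (by linarith) t
  calc (1 - β / n) ^ t * x ≤ (1 - β / n) ^ t * (8 * n) := mul_le_mul_of_nonneg_left hx h0
    _ ≤ (ε / R) ^ 4 * (8 * n) := mul_le_mul_of_nonneg_right (h1.trans h2) (by linarith)
    _ ≤ ε := by
      rw [div_pow, div_mul_eq_mul_div, div_le_iff₀ (by positivity)]
      have a1 : ε ^ 4 ≤ ε := by
        simpa using pow_le_pow_of_le_one hε0.le hε1.le (show 1 ≤ 4 by norm_num)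
      have a2 : 3 ^ 3 ≤ R ^ 3 := pow_le_pow_left₀ (by norm_num) (by linarith) 3
      have a3 : 8 * n ≤ R ^ 4 := by nlinarith
      exact mul_le_mul a1 a3 (by linarith) hε0.le

end Parameters

/-- For a hardcore instance `I = (V,E,λ)` with maximum degree `Δ ≥ 3` and
fugacity `λ ≤ (2−δ)/(Δ−2)` (constant `δ ∈ (0,1]`), there is a potential function
`ρ_I : Ω_I × Ω_I → ℝ_{≥0}` with `ρ_I(σ,σ) = 0`, `ρ_I(σ,τ) ≥ 1` for `σ ≠ τ`, and
`Diam_I = max ρ_I ≤ Δn`, such that: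
(1) every one-step optimal coupling of the Gibbs sampling chain on `I` satisfies on feasible
configurations the step-wise decay
`E[ρ_I(X_t,Y_t) | X_{t−1}=σ ∧ Y_{t−1}=τ] ≤ (1 − (δ/96)/n)·ρ_I(σ,τ)`, and consequently
`τ_mix(I,ε) ≤ ⌈(96n/δ)·log(Diam_I/ε)⌉`;
(2) `H(σ,τ) ≤ ρ_I(σ,τ)`;
(3) `ρ_I` is `12Δ`-Lipschitz with respect to the Hamming distance on pairs. -/
theorem hardcore_potential_function_exists
    {V : Type*} [Fintype V] [DecidableEq V] [Nonempty V]
    (G : SimpleGraph V) [DecidableRel G.Adj]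
    (δ lam : ℝ) (hδ0 : 0 < δ) (hδ1 : δ ≤ 1)
    (hΔ : 3 ≤ G.maxDegree) (hlam0 : 0 < lam)
    (hlam : lam ≤ (2 - δ) / ((G.maxDegree : ℝ) - 2)) :
    ∃ ρ : (V → Bool) → (V → Bool) → ℝ, ∃ DiamI : ℝ,
      DiamI = sSup {d : ℝ | ∃ σ τ : V → Bool, IsIndep G σ ∧ IsIndep G τ ∧ d = ρ σ τ} ∧
      (∀ σ τ : V → Bool, IsIndep G σ → IsIndep G τ → 0 ≤ ρ σ τ) ∧
      (∀ σ : V → Bool, IsIndep G σ → ρ σ σ = 0) ∧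
      (∀ σ τ : V → Bool, IsIndep G σ → IsIndep G τ → σ ≠ τ → 1 ≤ ρ σ τ) ∧
      DiamI ≤ (G.maxDegree : ℝ) * (Fintype.card V : ℝ) ∧
      -- (1) step-wise decay under every one-step optimal coupling
      (∀ Dopt : V → (V → Bool) → (V → Bool) → Bool → Bool → ℝ,
        (∀ (v : V) (σ τ : V → Bool),
          IsOptimalCoupling (margHC G lam v σ) (margHC G lam v τ) (Dopt v σ τ)) →
        ∀ σ τ : V → Bool, IsIndep G σ → IsIndep G τ →
          (Fintype.card V : ℝ)⁻¹ * ∑ v, ∑ b, ∑ b',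
              Dopt v σ τ b b' * ρ (Function.update σ v b) (Function.update τ v b')
            ≤ (1 - (δ / 96) / (Fintype.card V : ℝ)) * ρ σ τ) ∧
      -- (1 cont.) mixing-time consequence
      (∀ ε : ℝ, 0 < ε → ε < 1 → ∀ σ0 : V → Bool,
        sInf {t : ℕ |
            tvDist (chainDist (gibbsStepHC G lam) (initDelta σ0) t) (hcGibbs G lam) ≤ ε}
          ≤ ⌈(96 * (Fintype.card V : ℝ) / δ) * Real.log (DiamI / ε)⌉₊) ∧
      -- (2) upper bound to Hamming
      (∀ σ τ : V → Bool, IsIndep G σ → IsIndep G τ → (hammingDist σ τ : ℝ) ≤ ρ σ τ) ∧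
      -- (3) Lipschitz
      (∀ σ σ' τ τ' : V → Bool,
        IsIndep G σ → IsIndep G σ' → IsIndep G τ → IsIndep G τ' →
        |ρ σ τ - ρ σ' τ'| ≤
          12 * (G.maxDegree : ℝ) * ((hammingDist σ σ' : ℝ) + (hammingDist τ τ' : ℝ))) := by
  have hD3 : 3 ≤ (G.maxDegree : ℝ) := by exact_mod_cast hΔ
  have hn4 : 4 ≤ (Fintype.card V : ℝ) := by
    have h4 : 4 ≤ Fintype.card V := hΔ.trans_lt G.maxDegree_lt_card_verts
    exact_mod_cast h4
  have hn0 : 0 ≤ (Fintype.card V : ℝ)⁻¹ := by positivity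
  have hlD := fugacity_mul_le hD3 hlam
  have hl2 := fugacity_le hD3 hlam0 hlD
  have hpD := occupation_mul_le hδ0 hD3 hlam0 hlD
  have hp0 : 0 ≤ lam / (1 + lam) := by positivity
  have hp1 : lam / (1 + lam) ≤ 2 / 3 := by
    rw [div_le_iff₀ (by linarith)]
    linarith
  have hc0 := blockWeight_nonneg hδ0 hlam0
  have hc1 := blockWeight_le_one hδ0 hl2
  have hcqD := blockWeight_mul_vacancy_mul_le hδ0 hlam0 hpD
  have hcβ := mul_blockWeight_le hδ0 hδ1 hlam0 (by linarith)
  have hopt := @sum_optimalCoupling V _ G _ lam _ hlam0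
  have hker := sum_gibbsStepHC_mul G hlam0
  generalize blockWeight δ lam = c at *
  generalize lam / (1 + lam) = p at *
  have hcpD : c * p * G.maxDegree ≤ 3 * (1 - δ / 24) := by
    have := mul_le_mul_of_nonneg_right hc1 (mul_nonneg hp0 (by linarith : 0 ≤ (G.maxDegree : ℝ)))
    linarith
  have hcD : c * G.maxDegree ≤ 3 := by
    have := mul_le_mul_of_nonneg_left (by linarith : 1 / 3 ≤ 1 - p)
      (mul_nonneg hc0 (by linarith : 0 ≤ (G.maxDegree : ℝ)))
    linarith
  have step := sum_potential_step_le G hp0 (by linarith) (add_sub_cancel p 1) hc0 hcqD hcβ hcpD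
  obtain ⟨K, hK⟩ : ∃ K : ℝ, K = G.maxDegree / (1 + c) := ⟨_, rfl⟩
  have hK1 : 1 ≤ K := by
    rw [hK, le_div_iff₀ (by linarith)]
    linarith
  have hK0 : 0 ≤ K := zero_le_one.trans hK1
  have hKc : K * (1 + c) = G.maxDegree := by
    rw [hK]
    field_simp
  have hKD : K ≤ G.maxDegree := hKc ▸ le_mul_of_one_le_right hK0 (by linarith)
  have hρD := numDisagr_le_scaledPotential G hK1 hc0
  have hdiam : ∀ d ∈ {d : ℝ | ∃ σ τ : V → Bool, IsIndep G σ ∧ IsIndep G τ ∧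
      d = scaledPotential G K c σ τ}, d ≤ G.maxDegree * Fintype.card V := by
    rintro d ⟨σ, τ, _, _, rfl⟩
    exact hKc ▸ scaledPotential_le G hK0 hc0 σ τ
  refine ⟨scaledPotential G K c, _, rfl,
    fun σ τ _ _ => (numDisagr_nonneg σ τ).trans (hρD σ τ),
    fun σ _ => scaledPotential_self G K c σ,
    fun σ τ _ _ h => (one_le_numDisagr h).trans (hρD σ τ),
    csSup_le ⟨_, _, _, isIndep_empty G, isIndep_empty G, rfl⟩ hdiam, ?_, ?_, ?_, ?_⟩
  · intro Dopt hD σ τ hσ hτ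
    simp only [fun v => hopt (hD v σ τ) (scaledPotential G K c)]
    have hle := scaledPotential_le_mul_potential G hK0 c
    have h1 : ∑ v, (p * scaledPotential G K c (tryOccupy G σ v) (tryOccupy G τ v) +
        (1 - p) * scaledPotential G K c (vacate σ v) (vacate τ v)) ≤
        (Fintype.card V - δ / 24) * scaledPotential G K c σ τ := by
      rw [scaledPotential_of_isIndep G K c hσ hτ, mul_left_comm]
      refine le_trans ?_ (mul_le_mul_of_nonneg_left (step σ τ) hK0)
      rw [Finset.mul_sum]
      refine Finset.sum_le_sum fun v _ => ?_
      have a1 := mul_le_mul_of_nonneg_left (hle (tryOccupy G σ v) (tryOccupy G τ v)) hp0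
      have a2 := mul_le_mul_of_nonneg_left (hle (vacate σ v) (vacate τ v))
        (by linarith : 0 ≤ 1 - p)
      linarith
    have h2 : (Fintype.card V - δ / 24) * scaledPotential G K c σ τ ≤
        (Fintype.card V - δ / 96) * scaledPotential G K c σ τ :=
      mul_le_mul_of_nonneg_right (by linarith) ((numDisagr_nonneg σ τ).trans (hρD σ τ))
    refine (mul_le_mul_of_nonneg_left (h1.trans h2) hn0).trans_eq ?_
    field_simp
  · intro ε hε0 hε1 σ0
    refine Nat.sInf_le ?_
    have hβn : δ / 24 / (Fintype.card V : ℝ) ≤ 1 := by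
      rw [div_le_one (by linarith)]
      linarith
    obtain ⟨σ₁, hσ₁, hlow⟩ := exists_isIndep_le_scaledPotential G hc0 hc1 hD3 hKc
    refine (tvDist_chainDist_le (r := 1 - δ / 24 / Fintype.card V) (by linarith)
      (potential_le G hc1) (potential_nonneg G hc0) ?_ (hcGibbs_nonneg G hlam0)
      (sum_hcGibbs G hlam0) (hcGibbs_stationary G hlam0) (sum_gibbsStepHC G hlam0) ?_ σ0 _).trans
      (mixing_bound _ hn4 hε0 hε1
        (hlow.trans (le_csSup ⟨_, hdiam⟩ ⟨_, σ₁, isIndep_empty G, hσ₁, rfl⟩))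
        hβn ?_ (by positivity) (Nat.le_ceil _) le_rfl)
    · intro σ τ h
      have := numDisagr_add_le_potential G c σ τ
      have := mul_nonneg hc0 (numBlockDisagr_nonneg G σ τ)
      linarith [one_le_numDisagr h]
    · intro f L hL hf σ τ
      rw [hker, hker, ← mul_sub, ← Finset.sum_sub_distrib]
      have h1 : ∑ v, (p * f (tryOccupy G σ v) + (1 - p) * f (vacate σ v) -
          (p * f (tryOccupy G τ v) + (1 - p) * f (vacate τ v))) ≤
          L * ((Fintype.card V - δ / 24) * potential G c σ τ) := by
        refine le_trans ?_ (mul_le_mul_of_nonneg_left (step σ τ) hL)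
        rw [Finset.mul_sum]
        refine Finset.sum_le_sum fun v _ => ?_
        have a1 := mul_le_mul_of_nonneg_left (hf (tryOccupy G σ v) (tryOccupy G τ v)) hp0
        have a2 := mul_le_mul_of_nonneg_left (hf (vacate σ v) (vacate τ v))
          (by linarith : 0 ≤ 1 - p)
        linarith
      refine (mul_le_mul_of_nonneg_left h1 hn0).trans_eq ?_
      field_simp
    · field_simp
      norm_num
  · intro σ τ _ _
    rw [← numDisagr_eq_hammingDist]
    exact hρD σ τ
  · intro σ σ' τ τ' _ _ _ _
    rw [← numDisagr_eq_hammingDist, ← numDisagr_eq_hammingDist]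
    exact abs_scaledPotential_sub_le G hc0 hK0 hKD hcD σ σ' τ τ'
end

section
/- Let δ ∈ (0,1] be a constant, and let I = (V,E,λ) and I' = (V,E,λ') be hardcore instances on the same graph G = (V,E) with n = |V| and maximum degree Δ ≥ 3. Assume λ ≤ (2−δ)/(Δ−2) and that the Hamiltonian difference d_Ham(I,I') = n·|ln λ − ln λ'| is at most L. Run the one-step local coupling for Hamiltonian update between the Gibbs sampling chains on I and I' for T steps from the all-zero initial configuration X_0 = Y_0 = 0^V, with filter probabilities p̂_v = min{2|ln λ − ln λ'|, 1}, random filter set P ⊆ {1,…,T} containing each step t independently with probability p̂_{v_t}, D_t = {v : X_t(v) ≠ Y_t(v)}, and R_Ham = Σ_{t=1}^T 1{t ∈ P or v_t ∈ Γ⁺(D_{t−1})}. Then E[R_Ham] ≤ 50000·Δ²·T·L/(δ·n); in particular E[R_Ham] = O(Δ²TL/(nδ)). -/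
open Finset
open scoped ENNReal

section PairChains

variable {S : Type*} [Fintype S]

theorem chainDist_nonneg {P : S → S → ℝ} {init : S → ℝ}
    (hP : ∀ s s', 0 ≤ P s s') (hinit : ∀ s, 0 ≤ init s) (t : ℕ) (s : S) :
    0 ≤ chainDist P init t s := by
  induction t generalizing s with
  | zero => exact hinit s
  | succ t ih => exact Finset.sum_nonneg fun x _ => mul_nonneg (ih x) (hP x s)

theorem sum_chainDist_succ_mul (P : S → S → ℝ) (init F : S → ℝ) (t : ℕ) :
    ∑ s, chainDist P init (t + 1) s * F s =
      ∑ s, chainDist P init t s * ∑ s', P s s' * F s' := by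
  simp only [chainDist, Finset.sum_mul, Finset.mul_sum]
  rw [Finset.sum_comm]
  simp only [mul_assoc]

theorem sum_initDelta_mul [DecidableEq S] (s₀ : S) (F : S → ℝ) :
    ∑ s, initDelta s₀ s * F s = F s₀ := by
  simp [initDelta]

theorem sum_chainDist_eq_one [DecidableEq S] {P : S → S → ℝ} (hP1 : ∀ s, ∑ s', P s s' = 1)
    (s₀ : S) (t : ℕ) :
    ∑ s, chainDist P (initDelta s₀) t s = 1 := by
  induction t with
  | zero => simpa [chainDist] using sum_initDelta_mul s₀ (fun _ => 1)
  | succ t ih =>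
    have h := sum_chainDist_succ_mul P (initDelta s₀) (fun _ => 1) t
    simpa [hP1, ih] using h

theorem chainDist_support [DecidableEq S] {P : S → S → ℝ} {s₀ : S} {Inv : S → Prop} (h₀ : Inv s₀)
    (hInv : ∀ s s', Inv s → P s s' ≠ 0 → Inv s') (t : ℕ) (s : S)
    (hs : chainDist P (initDelta s₀) t s ≠ 0) : Inv s := by
  induction t generalizing s with
  | zero =>
    have : s = s₀ := by
      by_contra hne
      exact hs (by simp [chainDist, initDelta, hne])
    exact this ▸ h₀
  | succ t ih =>
    obtain ⟨x, -, hx⟩ := Finset.exists_ne_zero_of_sum_ne_zero hs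
    exact hInv x s (ih x (left_ne_zero_of_mul hx)) (right_ne_zero_of_mul hx)

/-- A nonnegative potential that drifts down by `g` up to an error `K` on an invariant set
bounds the accumulated expectation of `g`. -/
theorem sum_expectation_le_of_drift [DecidableEq S] {P : S → S → ℝ} {s₀ : S} {Inv : S → Prop}
    (hP : ∀ s s', 0 ≤ P s s') (hP1 : ∀ s, ∑ s', P s s' = 1) (h₀ : Inv s₀)
    (hInv : ∀ s s', Inv s → P s s' ≠ 0 → Inv s') {Φ g : S → ℝ} {K : ℝ}
    (hΦ : ∀ s, 0 ≤ Φ s)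
    (hdrift : ∀ s, Inv s → ∑ s', P s s' * Φ s' ≤ Φ s - g s + K) (T : ℕ) :
    ∑ t ∈ Finset.range T, ∑ s, chainDist P (initDelta s₀) t s * g s ≤ Φ s₀ + T * K := by
  have hnn := chainDist_nonneg (init := initDelta s₀) hP
    (fun s => by unfold initDelta; split_ifs <;> norm_num)
  suffices h : ∑ t ∈ Finset.range T, ∑ s, chainDist P (initDelta s₀) t s * g s
      + ∑ s, chainDist P (initDelta s₀) T s * Φ s ≤ Φ s₀ + T * K by
    have : 0 ≤ ∑ s, chainDist P (initDelta s₀) T s * Φ s :=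
      Finset.sum_nonneg fun s _ => mul_nonneg (hnn T s) (hΦ s)
    linarith
  induction T with
  | zero => simpa [chainDist] using (sum_initDelta_mul s₀ Φ).le
  | succ T ih =>
    have step : ∑ s, chainDist P (initDelta s₀) (T + 1) s * Φ s ≤
        ∑ s, chainDist P (initDelta s₀) T s * Φ s
          - ∑ s, chainDist P (initDelta s₀) T s * g s + K := by
      rw [sum_chainDist_succ_mul]
      calc ∑ s, chainDist P (initDelta s₀) T s * ∑ s', P s s' * Φ s'
          ≤ ∑ s, chainDist P (initDelta s₀) T s * (Φ s - g s + K) := by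
            refine Finset.sum_le_sum fun s _ => ?_
            by_cases hs : chainDist P (initDelta s₀) T s = 0
            · simp [hs]
            · exact mul_le_mul_of_nonneg_left
                (hdrift s (chainDist_support h₀ hInv T s hs)) (hnn T s)
        _ = _ := by
            simp only [mul_add, mul_sub, Finset.sum_add_distrib, Finset.sum_sub_distrib,
              ← Finset.sum_mul, sum_chainDist_eq_one hP1, one_mul]
    rw [Finset.sum_range_succ]
    push_cast
    linarith

end PairChains

section PairKernel

variable {V Q : Type*} [Fintype Q]

open Classical in
theorem sum_ite_agree_off_mul [DecidableEq V] (v : V) (p : (V → Q) × (V → Q)) (w : Q → Q → ℝ)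
    (F : (V → Q) × (V → Q) → ℝ)
    [Fintype ((V → Q) × (V → Q))] :
    ∑ p' : (V → Q) × (V → Q),
      (if (∀ u, u ≠ v → p'.1 u = p.1 u) ∧ (∀ u, u ≠ v → p'.2 u = p.2 u)
        then w (p'.1 v) (p'.2 v) else 0) * F p' =
      ∑ c, ∑ d, w c d * F (Function.update p.1 v c, Function.update p.2 v d) := by
  simp only [ite_mul, zero_mul]
  rw [← Finset.sum_filter, ← Finset.sum_product']
  have key : ∀ (a b : V → Q), (∀ u, u ≠ v → a u = b u) → Function.update b v (a v) = a := by
    intro a b h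
    ext u
    by_cases hu : u = v
    · subst hu; simp
    · simp [hu, h u hu]
  refine Finset.sum_bij' (fun p' _ => (p'.1 v, p'.2 v))
    (fun c _ => (Function.update p.1 v c.1, Function.update p.2 v c.2)) ?_ ?_ ?_ ?_ ?_
  · simp
  · intro c _
    simp only [Finset.mem_filter, Finset.mem_univ, true_and]
    exact ⟨fun u hu => by simp [hu], fun u hu => by simp [hu]⟩
  · intro p' hp'
    simp only [Finset.mem_filter, Finset.mem_univ, true_and] at hp'
    exact Prod.ext (key _ _ hp'.1) (key _ _ hp'.2)
  · simp
  · intro p' hp'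
    simp only [Finset.mem_filter, Finset.mem_univ, true_and] at hp'
    simp only [key _ _ hp'.1, key _ _ hp'.2]

theorem sum_pairKernel_mul [Fintype V] [DecidableEq V] (Dloc : V → (V → Q) → (V → Q) → Q → Q → ℝ)
    (p : (V → Q) × (V → Q)) (F : (V → Q) × (V → Q) → ℝ) :
    ∑ p', pairKernel Dloc p p' * F p' = (Fintype.card V : ℝ)⁻¹ * ∑ v, ∑ c, ∑ d,
      Dloc v p.1 p.2 c d * F (Function.update p.1 v c, Function.update p.2 v d) := by
  classical
  simp only [pairKernel, mul_assoc, Finset.sum_mul]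
  rw [← Finset.mul_sum, Finset.sum_comm]
  congr 1
  refine Finset.sum_congr rfl fun v _ => ?_
  convert sum_ite_agree_off_mul v p (Dloc v p.1 p.2) F

theorem exists_of_pairKernel_ne_zero [Fintype V] {Dloc : V → (V → Q) → (V → Q) → Q → Q → ℝ}
    {p p' : (V → Q) × (V → Q)} (h : pairKernel Dloc p p' ≠ 0) :
    ∃ v, (∀ u, u ≠ v → p'.1 u = p.1 u) ∧ (∀ u, u ≠ v → p'.2 u = p.2 u) ∧
      Dloc v p.1 p.2 (p'.1 v) (p'.2 v) ≠ 0 := by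
  obtain ⟨v, -, hv⟩ := Finset.exists_ne_zero_of_sum_ne_zero (right_ne_zero_of_mul h)
  split_ifs at hv with hoff
  exacts [⟨v, hoff.1, hoff.2, hv⟩, absurd rfl hv]

end PairKernel

section HamCoupling

variable {Q : Type*} {μ μ' : Q → ℝ}

theorem pResample_nonneg (hμ : ∀ c, 0 ≤ μ c) (c : Q) : 0 ≤ pResample μ μ' c := by
  unfold pResample
  split_ifs with h
  · exact le_rfl
  · exact div_nonneg (by linarith) (hμ c)

theorem pResample_le_one (hμ : ∀ c, 0 ≤ μ c) (hμ' : ∀ c, 0 ≤ μ' c) (c : Q) :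
    pResample μ μ' c ≤ 1 := by
  unfold pResample
  split_ifs with h
  · exact zero_le_one
  · exact div_le_one_of_le₀ (by linarith [hμ' c]) (hμ c)

theorem mul_pResample (hμ' : ∀ c, 0 ≤ μ' c) (c : Q) :
    μ c * pResample μ μ' c = max 0 (μ c - μ' c) := by
  unfold pResample
  split_ifs with h
  · rw [mul_zero, max_eq_left (by linarith)]
  · have := hμ' c
    rw [mul_div_cancel₀ _ (by intro h0; linarith), max_eq_right (by linarith)]

theorem nuResample_nonneg [Fintype Q] (b : Q) : 0 ≤ nuResample μ μ' b :=
  div_nonneg (le_max_left _ _) (Finset.sum_nonneg fun _ _ => le_max_left _ _)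

theorem sum_nuResample_of_pResample_ne_zero [Fintype Q] (h1 : ∑ c, μ c = ∑ c, μ' c) {c : Q}
    (hc : pResample μ μ' c ≠ 0) : ∑ b, nuResample μ μ' b = 1 := by
  have hlt : μ' c < μ c := by
    by_contra h
    exact hc (by simp [pResample, not_lt.mp h])
  have hpos : 0 < ∑ x, max 0 (μ x - μ' x) :=
    Finset.sum_pos' (fun _ _ => le_max_left _ _)
      ⟨c, Finset.mem_univ c, lt_max_of_lt_right (by linarith)⟩
  have heq : ∑ x, max 0 (μ' x - μ x) = ∑ x, max 0 (μ x - μ' x) := by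
    rw [← sub_eq_zero, ← Finset.sum_sub_distrib]
    have : ∀ x, max 0 (μ' x - μ x) - max 0 (μ x - μ' x) = μ' x - μ x := by
      intro x
      rcases le_total (μ x) (μ' x) with h | h
      · rw [max_eq_right (by linarith), max_eq_left (by linarith), sub_zero]
      · rw [max_eq_left (by linarith), max_eq_right (by linarith)]; ring
    simp only [this, Finset.sum_sub_distrib, h1, sub_self]
  simp only [nuResample]
  rw [← Finset.sum_div, heq, div_self hpos.ne']

theorem hamCoupling_nonneg [Fintype Q] {D : Q → Q → ℝ} (hμ : ∀ c, 0 ≤ μ c) (hμ' : ∀ c, 0 ≤ μ' c)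
    (hD : ∀ c d, 0 ≤ D c d) (c d : Q) : 0 ≤ hamCoupling μ μ' D c d := by
  refine add_nonneg (mul_nonneg (hD c d) (sub_nonneg.2 (pResample_le_one hμ hμ' d)))
    (mul_nonneg (nuResample_nonneg d) (Finset.sum_nonneg fun x _ =>
      mul_nonneg (hD c x) (pResample_nonneg hμ x)))

theorem sum_hamCoupling_mul [Fintype Q] (D : Q → Q → ℝ) (f : Q → Q → ℝ) :
    ∑ c, ∑ d, hamCoupling μ μ' D c d * f c d = ∑ c, ∑ d, D c d * f c d +
      ∑ c, ∑ c', D c c' *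
        (pResample μ μ' c' * (∑ d, nuResample μ μ' d * f c d - f c c')) := by
  rw [← Finset.sum_add_distrib]
  refine Finset.sum_congr rfl fun c _ => ?_
  have h : ∑ d, (nuResample μ μ' d * ∑ c', D c c' * pResample μ μ' c') * f c d =
      ∑ c', D c c' * (pResample μ μ' c' * ∑ d, nuResample μ μ' d * f c d) := by
    simp only [← mul_assoc]
    rw [← Finset.sum_mul, mul_comm, Finset.sum_mul]
    exact Finset.sum_congr rfl fun d _ => by ring
  simp only [hamCoupling, add_mul, Finset.sum_add_distrib, h]
  rw [← Finset.sum_add_distrib, ← Finset.sum_add_distrib]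
  exact Finset.sum_congr rfl fun d _ => by ring

theorem sum_hamCoupling [Fintype Q] {D : Q → Q → ℝ} (h1 : ∑ c, μ c = ∑ c, μ' c) :
    ∑ c, ∑ d, hamCoupling μ μ' D c d = ∑ c, ∑ d, D c d := by
  have h := sum_hamCoupling_mul (μ := μ) (μ' := μ') D (fun _ _ => 1)
  simp only [mul_one] at h
  rw [h, add_eq_left]
  refine Finset.sum_eq_zero fun c _ => Finset.sum_eq_zero fun c' _ => ?_
  by_cases hc : pResample μ μ' c' = 0
  · simp [hc]
  · simp [sum_nuResample_of_pResample_ne_zero h1 hc]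

/-- Resampling the second coordinate costs at most its oscillation `K` times the mass moved. -/
theorem sum_hamCoupling_mul_le [Fintype Q] {D : Q → Q → ℝ} {f : Q → Q → ℝ} {ρ : Q → ℝ} {K : ℝ}
    (hμ : ∀ c, 0 ≤ μ c) (hμ' : ∀ c, 0 ≤ μ' c) (h1 : ∑ c, μ c = ∑ c, μ' c)
    (hD : IsCoupling ρ μ D) (hf : ∀ c d d', f c d ≤ f c d' + K) :
    ∑ c, ∑ d, hamCoupling μ μ' D c d * f c d ≤
      ∑ c, ∑ d, D c d * f c d + K * ∑ c, max 0 (μ c - μ' c) := by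
  rw [sum_hamCoupling_mul]
  gcongr
  calc ∑ c, ∑ c', D c c' * (pResample μ μ' c' * (∑ d, nuResample μ μ' d * f c d - f c c'))
      ≤ ∑ c, ∑ c', D c c' * (pResample μ μ' c' * K) := by
        refine Finset.sum_le_sum fun c _ => Finset.sum_le_sum fun c' _ => ?_
        refine mul_le_mul_of_nonneg_left ?_ (hD.1 c c')
        by_cases hc : pResample μ μ' c' = 0
        · simp [hc]
        · refine mul_le_mul_of_nonneg_left ?_ (pResample_nonneg hμ c')
          have hν := sum_nuResample_of_pResample_ne_zero h1 hc
          have : ∑ d, nuResample μ μ' d * f c d ≤ ∑ d, nuResample μ μ' d * (f c c' + K) :=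
            Finset.sum_le_sum fun d _ =>
              mul_le_mul_of_nonneg_left (hf c d c') (nuResample_nonneg d)
          rw [← Finset.sum_mul, hν] at this
          linarith
    _ = K * ∑ c, max 0 (μ c - μ' c) := by
        rw [Finset.sum_comm, Finset.mul_sum]
        refine Finset.sum_congr rfl fun c' _ => ?_
        rw [← Finset.sum_mul, hD.2.2 c', ← mul_pResample hμ']
        ring

end HamCoupling

section BoolCoupling

theorem IsCoupling.eq_zero_of_left {Q : Type*} [Fintype Q] {μ ν : Q → ℝ} {D : Q → Q → ℝ}
    (h : IsCoupling μ ν D) {c : Q} (hc : μ c = 0) (d : Q) : D c d = 0 :=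
  (Finset.sum_eq_zero_iff_of_nonneg fun d _ => h.1 c d).1 ((h.2.1 c).trans hc) d
    (Finset.mem_univ d)

theorem IsCoupling.eq_zero_of_right {Q : Type*} [Fintype Q] {μ ν : Q → ℝ} {D : Q → Q → ℝ}
    (h : IsCoupling μ ν D) {d : Q} (hd : ν d = 0) (c : Q) : D c d = 0 :=
  (Finset.sum_eq_zero_iff_of_nonneg fun c _ => h.1 c d).1 ((h.2.2 d).trans hd) c
    (Finset.mem_univ c)

theorem IsOptimalCoupling.apply_self {μ : Bool → ℝ} {D : Bool → Bool → ℝ}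
    (h : IsOptimalCoupling μ μ D) :
    D true true = μ true ∧ D false false = μ false ∧ D true false = 0 ∧ D false true = 0 := by
  obtain ⟨⟨h0, hl, hr⟩, hopt⟩ := h
  have hμ : ∀ c, 0 ≤ μ c := fun c => hl c ▸ Finset.sum_nonneg fun d _ => h0 c d
  have hd := hopt (fun c d => if c = d then μ c else 0)
    ⟨fun c d => by
      dsimp only
      split_ifs
      exacts [hμ c, le_rfl], fun c => by simp, fun c => by simp⟩
  simp only [Fintype.sum_bool, if_true] at hd hl hr
  have := h0 true false
  have := h0 false true
  have := hl true
  have := hl false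
  refine ⟨?_, ?_, ?_, ?_⟩ <;> linarith

end BoolCoupling

section Hardcore

variable {V : Type*}

/-- The vertex `v` has an occupied neighbour in the configuration `σ`. -/
def Blocked (G : SimpleGraph V) (σ : V → Bool) (v : V) : Prop :=
  ∃ u, G.Adj v u ∧ σ u = true

open Classical in
/-- The indicator of a disagreement at `v`. -/
noncomputable def disagree (p : (V → Bool) × (V → Bool)) (v : V) : ℝ :=
  if p.1 v = p.2 v then 0 else 1

open Classical in
/-- The indicator of `v` being blocked in exactly one of the two configurations. -/
noncomputable def halfBlocked (G : SimpleGraph V) (p : (V → Bool) × (V → Bool)) (v : V) : ℝ :=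
  if (Blocked G p.1 v ↔ Blocked G p.2 v) then 0 else 1

/-- The potential counting disagreements and, with weight `β`, vertices blocked in
exactly one of the two configurations. -/
noncomputable def pairPotential [Fintype V] (G : SimpleGraph V) (β : ℝ)
    (p : (V → Bool) × (V → Bool)) : ℝ :=
  ∑ v, disagree p v + β * ∑ v, halfBlocked G p v

theorem disagree_nonneg (p : (V → Bool) × (V → Bool)) (v : V) : 0 ≤ disagree p v := by
  unfold disagree; split_ifs <;> norm_num

theorem disagree_le_one (p : (V → Bool) × (V → Bool)) (v : V) : disagree p v ≤ 1 := by
  unfold disagree; split_ifs <;> norm_num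

theorem halfBlocked_nonneg (G : SimpleGraph V) (p : (V → Bool) × (V → Bool)) (v : V) :
    0 ≤ halfBlocked G p v := by
  unfold halfBlocked; split_ifs <;> norm_num

theorem halfBlocked_le_one (G : SimpleGraph V) (p : (V → Bool) × (V → Bool)) (v : V) :
    halfBlocked G p v ≤ 1 := by
  unfold halfBlocked; split_ifs <;> norm_num

theorem halfBlocked_eq_zero {G : SimpleGraph V} {p : (V → Bool) × (V → Bool)} {v : V}
    (h : Blocked G p.1 v ↔ Blocked G p.2 v) : halfBlocked G p v = 0 := if_pos h

theorem halfBlocked_eq_one {G : SimpleGraph V} {p : (V → Bool) × (V → Bool)} {v : V}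
    (h : ¬(Blocked G p.1 v ↔ Blocked G p.2 v)) : halfBlocked G p v = 1 := if_neg h

theorem halfBlocked_eq_zero_of_agree {G : SimpleGraph V} {p : (V → Bool) × (V → Bool)} {v : V}
    (h : ∀ u, G.Adj v u → p.1 u = p.2 u) : halfBlocked G p v = 0 :=
  halfBlocked_eq_zero (exists_congr fun u => and_congr_right fun hu => by rw [h u hu])

theorem pairPotential_nonneg [Fintype V] (G : SimpleGraph V) {β : ℝ} (hβ : 0 ≤ β)
    (p : (V → Bool) × (V → Bool)) : 0 ≤ pairPotential G β p :=
  add_nonneg (Finset.sum_nonneg fun v _ => disagree_nonneg p v)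
    (mul_nonneg hβ (Finset.sum_nonneg fun v _ => halfBlocked_nonneg G p v))

section Marginals

variable [Fintype V] (G : SimpleGraph V) [DecidableRel G.Adj]

theorem margHC_of_blocked (lam : ℝ) {v : V} {τ : V → Bool} (h : Blocked G τ v) (b : Bool) :
    margHC G lam v τ b = if b then 0 else 1 := by
  have h' : ¬ ∀ u ∈ G.neighborFinset v, τ u = false := by
    obtain ⟨u, hu, hτ⟩ := h
    intro hall
    simp [hall u (by simpa using hu)] at hτ
  simp only [margHC, if_neg h']
  simp

theorem margHC_of_not_blocked (lam : ℝ) {v : V} {τ : V → Bool} (h : ¬Blocked G τ v) (b : Bool) :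
    margHC G lam v τ b = if b then lam / (1 + lam) else 1 / (1 + lam) := by
  have h' : ∀ u ∈ G.neighborFinset v, τ u = false := by
    intro u hu
    by_contra hτ
    exact h ⟨u, by simpa using hu, by simpa using hτ⟩
  cases b <;> simp only [margHC, if_pos h'] <;> simp

theorem margHC_nonneg {lam : ℝ} (hlam : 0 < lam) (v : V) (τ : V → Bool) (b : Bool) :
    0 ≤ margHC G lam v τ b := by
  by_cases h : Blocked G τ v
  · rw [margHC_of_blocked G lam h]; split_ifs <;> norm_num
  · rw [margHC_of_not_blocked G lam h]; split_ifs <;> positivity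

theorem sum_margHC {lam : ℝ} (hlam : 0 < lam) (v : V) (τ : V → Bool) :
    ∑ b, margHC G lam v τ b = 1 := by
  by_cases h : Blocked G τ v
  · simp [margHC_of_blocked G lam h]
  · simp only [margHC_of_not_blocked G lam h, Fintype.sum_bool]
    simp
    field_simp
    ring

open Classical in
/-- Expectations under an optimal coupling of two hardcore marginals: both copies use the
same coin of bias `λ / (1 + λ)`. -/
theorem sum_optimalCoupling_margHC {lam : ℝ} (hlam : 0 < lam) {v : V} {σ τ : V → Bool}
    {D : Bool → Bool → ℝ}
    (hD : IsOptimalCoupling (margHC G lam v σ) (margHC G lam v τ) D) (f : Bool → Bool → ℝ) :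
    ∑ c, ∑ d, D c d * f c d = 1 / (1 + lam) * f false false +
      lam / (1 + lam) * f (decide (¬Blocked G σ v)) (decide (¬Blocked G τ v)) := by
  have h1 : lam / (1 + lam) = 1 - 1 / (1 + lam) := by field_simp; ring
  by_cases hσ : Blocked G σ v <;> by_cases hτ : Blocked G τ v
  · have hσ' := margHC_of_blocked G lam hσ
    have e : margHC G lam v τ = margHC G lam v σ :=
      funext fun b => by rw [hσ', margHC_of_blocked G lam hτ]
    rw [e] at hD
    obtain ⟨htt, hff, htf, hft⟩ := hD.apply_self
    simp only [hσ'] at htt hff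
    simp [htt, hff, htf, hft, hσ, hτ, h1]
    ring
  · have hσ' := margHC_of_blocked G lam hσ
    have hτ' := margHC_of_not_blocked G lam hτ
    have h0 : ∀ d, D true d = 0 := hD.1.eq_zero_of_left (by simp [hσ'])
    have ht := hD.1.2.2 true
    have hf := hD.1.2.2 false
    simp only [Fintype.sum_bool, h0, hτ', zero_add] at ht hf
    simp [h0, ht, hf, hσ, hτ]
    ring
  · have hσ' := margHC_of_not_blocked G lam hσ
    have hτ' := margHC_of_blocked G lam hτ
    have h0 : ∀ c, D c true = 0 := hD.1.eq_zero_of_right (by simp [hτ'])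
    have ht := hD.1.2.1 true
    have hf := hD.1.2.1 false
    simp only [Fintype.sum_bool, h0, hσ', zero_add] at ht hf
    simp [h0, ht, hf, hσ, hτ]
    ring
  · have hσ' := margHC_of_not_blocked G lam hσ
    have e : margHC G lam v τ = margHC G lam v σ :=
      funext fun b => by rw [hσ', margHC_of_not_blocked G lam hτ]
    rw [e] at hD
    obtain ⟨htt, hff, htf, hft⟩ := hD.apply_self
    simp only [hσ'] at htt hff
    simp [htt, hff, htf, hft, hσ, hτ]
    ring

theorem inv_one_add_sub_le_log_sub {a b : ℝ} (ha : 0 < a) (hab : a ≤ b) :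
    1 / (1 + a) - 1 / (1 + b) ≤ Real.log b - Real.log a := by
  have hb : 0 < b := ha.trans_le hab
  have hlog := Real.log_le_sub_one_of_pos (div_pos ha hb)
  rw [Real.log_div ha.ne' hb.ne'] at hlog
  have h : 1 / (1 + a) - 1 / (1 + b) ≤ 1 - a / b := by
    rw [div_sub_div _ _ (by positivity) (by positivity), one_sub_div hb.ne',
      div_le_div_iff₀ (by positivity) hb]
    nlinarith [mul_nonneg (sub_nonneg.2 hab) (mul_pos ha hb).le,
      mul_nonneg (sub_nonneg.2 hab) ha.le]
  linarith

theorem sum_max_margHC_sub_le {lam lam' : ℝ} (hlam : 0 < lam) (hlam' : 0 < lam')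
    (v : V) (τ : V → Bool) :
    ∑ b, max 0 (margHC G lam v τ b - margHC G lam' v τ b) ≤
      |Real.log lam - Real.log lam'| := by
  by_cases h : Blocked G τ v
  · simp [margHC_of_blocked G _ h]
  · have key : ∀ x : ℝ, 0 < x → x / (1 + x) = 1 - 1 / (1 + x) := by
      intro x hx; field_simp; ring
    simp only [margHC_of_not_blocked G _ h, Fintype.sum_bool, if_true, Bool.false_eq_true,
      if_false, key _ hlam, key _ hlam']
    rcases le_total lam lam' with hle | hle
    · have := inv_one_add_sub_le_log_sub hlam hle
      have h2 : 1 / (1 + lam') ≤ 1 / (1 + lam) := by gcongr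
      rw [max_eq_left (by linarith), max_eq_right (by linarith), abs_sub_comm]
      linarith [le_abs_self (Real.log lam' - Real.log lam)]
    · have := inv_one_add_sub_le_log_sub hlam' hle
      have h2 : 1 / (1 + lam) ≤ 1 / (1 + lam') := by gcongr
      rw [max_eq_right (by linarith), max_eq_left (by linarith)]
      linarith [le_abs_self (Real.log lam - Real.log lam')]

theorem not_blocked_of_hamCoupling_ne_zero {lam lam' : ℝ} {v : V} {σ τ : V → Bool}
    {D : Bool → Bool → ℝ} (hD : IsCoupling (margHC G lam v σ) (margHC G lam v τ) D) {c d : Bool}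
    (h : hamCoupling (margHC G lam v τ) (margHC G lam' v τ) D c d ≠ 0) :
    (c = true → ¬Blocked G σ v) ∧ (d = true → ¬Blocked G τ v) := by
  constructor
  · rintro rfl hσ
    have h0 : ∀ d, D true d = 0 := hD.eq_zero_of_left (by simp [margHC_of_blocked G lam hσ])
    exact h (by simp [hamCoupling, h0])
  · rintro rfl hτ
    have h0 : ∀ c, D c true = 0 := hD.eq_zero_of_right (by simp [margHC_of_blocked G lam hτ])
    exact h (by simp [hamCoupling, nuResample, h0, margHC_of_blocked G _ hτ])

end Marginals

theorem sum_neighbor_disagree_le [Fintype V] (G : SimpleGraph V) [DecidableRel G.Adj]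
    (p : (V → Bool) × (V → Bool)) :
    ∑ w, ∑ v ∈ G.neighborFinset w, disagree p v ≤ G.maxDegree * ∑ v, disagree p v := by
  have : ∑ w, ∑ v ∈ G.neighborFinset w, disagree p v = ∑ v, G.degree v * disagree p v := by
    rw [Finset.sum_comm' (t' := Finset.univ) (s' := fun v => G.neighborFinset v)
      (by simp [G.adj_comm])]
    simp
  rw [this, Finset.mul_sum]
  refine Finset.sum_le_sum fun v _ => mul_le_mul_of_nonneg_right ?_ (disagree_nonneg p v)
  exact_mod_cast G.degree_le_maxDegree v

theorem sum_indNbr_le [Fintype V] (G : SimpleGraph V) [DecidableRel G.Adj]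
    (p : (V → Bool) × (V → Bool)) :
    ∑ v, indNbr G p v ≤ (G.maxDegree + 1) * ∑ v, disagree p v := by
  have h : ∀ v, indNbr G p v ≤ ∑ u ∈ G.neighborFinset v, disagree p u + disagree p v := by
    intro v
    have h0 := disagree_nonneg p v
    have hs : 0 ≤ ∑ u ∈ G.neighborFinset v, disagree p u :=
      Finset.sum_nonneg fun u _ => disagree_nonneg p u
    unfold indNbr
    split_ifs with hex
    · obtain ⟨u, rfl | hu, hne⟩ := hex
      · rw [show disagree p u = 1 from if_neg hne]
        linarith
      · have h1 : disagree p u = 1 := if_neg hne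
        have := Finset.single_le_sum (f := disagree p) (s := G.neighborFinset v)
          (fun x _ => disagree_nonneg p x) (by simpa using hu)
        linarith
    · linarith
  refine (Finset.sum_le_sum fun v _ => h v).trans ?_
  rw [Finset.sum_add_distrib, add_mul, one_mul]
  linarith [sum_neighbor_disagree_le G p]

theorem IsIndep.of_agree_off {G : SimpleGraph V} {σ σ' : V → Bool} (hσ : IsIndep G σ) {v : V}
    (hoff : ∀ u, u ≠ v → σ' u = σ u) (hv : σ' v = true → ¬Blocked G σ v) : IsIndep G σ' := by
  rintro x y hxy ⟨hx, hy⟩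
  by_cases hxv : x = v
  · subst hxv
    exact hv hx ⟨y, hxy, by rw [← hoff y hxy.ne', hy]⟩
  · by_cases hyv : y = v
    · subst hyv
      exact hv hy ⟨x, hxy.symm, by rw [← hoff x hxy.ne, hx]⟩
    · exact hσ x y hxy ⟨by rw [← hoff x hxv, hx], by rw [← hoff y hyv, hy]⟩

section Updates

variable [DecidableEq V]

/-- Set both copies to `c` and `d` at `v`. -/
def updatePair (p : (V → Bool) × (V → Bool)) (v : V) (c d : Bool) : (V → Bool) × (V → Bool) :=
  (Function.update p.1 v c, Function.update p.2 v d)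

open Classical in
/-- Attempt to occupy `v` in both copies. -/
noncomputable def occupyPair (G : SimpleGraph V) (p : (V → Bool) × (V → Bool)) (v : V) :
    (V → Bool) × (V → Bool) :=
  updatePair p v (decide (¬Blocked G p.1 v)) (decide (¬Blocked G p.2 v))

theorem blocked_update_of_not_adj {G : SimpleGraph V} {σ : V → Bool} {v w : V}
    (h : ¬G.Adj w v) (c : Bool) : Blocked G (Function.update σ v c) w ↔ Blocked G σ w := by
  refine exists_congr fun u => and_congr_right fun hu => ?_
  rw [Function.update_of_ne (by rintro rfl; exact h hu)]

theorem blocked_update_true {G : SimpleGraph V} {σ : V → Bool} {v w : V} (h : G.Adj w v) :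
    Blocked G (Function.update σ v true) w := ⟨v, h, by simp⟩

theorem blocked_update_false {G : SimpleGraph V} {σ : V → Bool} {v w : V} :
    Blocked G (Function.update σ v false) w ↔ ∃ u, G.Adj w u ∧ u ≠ v ∧ σ u = true := by
  refine exists_congr fun u => and_congr_right fun _ => ?_
  by_cases hu : u = v
  · subst hu; simp
  · simp [hu]

theorem Blocked.occupy {G : SimpleGraph V} {σ : V → Bool} (hσ : IsIndep G σ) {v w : V}
    (hw : Blocked G σ w) [Decidable (¬Blocked G σ v)] :
    Blocked G (Function.update σ v (decide (¬Blocked G σ v))) w := by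
  obtain ⟨u, hu, hσu⟩ := hw
  refine ⟨u, hu, ?_⟩
  by_cases huv : u = v
  · subst huv
    simp only [Function.update_self, decide_eq_true_eq]
    rintro ⟨x, hx, hσx⟩
    exact hσ _ _ hx ⟨hσu, hσx⟩
  · simpa [huv] using hσu

theorem halfBlocked_updatePair_of_not_adj {G : SimpleGraph V} {p : (V → Bool) × (V → Bool)}
    {v w : V} (h : ¬G.Adj w v) (c d : Bool) :
    halfBlocked G (updatePair p v c d) w = halfBlocked G p w := by
  by_cases hw : Blocked G p.1 w ↔ Blocked G p.2 w
  · rw [halfBlocked_eq_zero hw, halfBlocked_eq_zero]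
    simpa only [updatePair, blocked_update_of_not_adj h] using hw
  · rw [halfBlocked_eq_one hw, halfBlocked_eq_one]
    simpa only [updatePair, blocked_update_of_not_adj h] using hw

theorem disagree_updatePair_of_ne {p : (V → Bool) × (V → Bool)} {v w : V} (h : w ≠ v)
    (c d : Bool) : disagree (updatePair p v c d) w = disagree p w := by
  simp [disagree, updatePair, h]

variable (G : SimpleGraph V)

theorem pairPotential_updatePair_le [Fintype V] [DecidableRel G.Adj] {β : ℝ} (hβ : 0 ≤ β)
    (p : (V → Bool) × (V → Bool)) (v : V)
    (c d d' : Bool) :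
    pairPotential G β (updatePair p v c d) ≤
      pairPotential G β (updatePair p v c d') + (1 + β * G.maxDegree) := by
  have hD : ∑ w, disagree (updatePair p v c d) w ≤
      ∑ w, (disagree (updatePair p v c d') w + if w = v then 1 else 0) := by
    refine Finset.sum_le_sum fun w _ => ?_
    by_cases hw : w = v
    · rw [if_pos hw]
      linarith [disagree_le_one (updatePair p v c d) w, disagree_nonneg (updatePair p v c d') w]
    · simp [hw, disagree_updatePair_of_ne hw]
  have hB : ∑ w, halfBlocked G (updatePair p v c d) w ≤
      ∑ w, (halfBlocked G (updatePair p v c d') w + if G.Adj v w then 1 else 0) := by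
    refine Finset.sum_le_sum fun w _ => ?_
    by_cases hw : G.Adj v w
    · rw [if_pos hw]
      linarith [halfBlocked_le_one G (updatePair p v c d) w,
        halfBlocked_nonneg G (updatePair p v c d') w]
    · have hw' : ¬G.Adj w v := fun h => hw h.symm
      simp [hw, halfBlocked_updatePair_of_not_adj hw']
  have hdeg : ∑ w, (if G.Adj v w then (1 : ℝ) else 0) ≤ G.maxDegree := by
    rw [Finset.sum_boole, ← G.neighborFinset_eq_filter]
    exact_mod_cast G.degree_le_maxDegree v
  rw [Finset.sum_add_distrib] at hD hB
  simp only [Finset.sum_ite_eq', Finset.mem_univ, if_true] at hD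
  simp only [pairPotential]
  nlinarith [mul_le_mul_of_nonneg_left (hB.trans (add_le_add_right hdeg _)) hβ]

theorem sum_disagree_erase [Fintype V] (p : (V → Bool) × (V → Bool)) (v : V) :
    ∑ w, disagree (updatePair p v false false) w = ∑ w, disagree p w - disagree p v := by
  rw [← Finset.add_sum_erase _ _ (Finset.mem_univ v),
    ← Finset.add_sum_erase _ (disagree p) (Finset.mem_univ v),
    Finset.sum_congr rfl fun w hw => disagree_updatePair_of_ne (Finset.ne_of_mem_erase hw) _ _]
  simp [disagree, updatePair]

theorem sum_disagree_occupy [Fintype V] (p : (V → Bool) × (V → Bool)) (v : V) :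
    ∑ w, disagree (occupyPair G p v) w =
      ∑ w, disagree p w - disagree p v + halfBlocked G p v := by
  have h : disagree (occupyPair G p v) v = halfBlocked G p v := by
    by_cases hv : Blocked G p.1 v ↔ Blocked G p.2 v
    · rw [halfBlocked_eq_zero hv]
      simp [disagree, occupyPair, updatePair, hv]
    · rw [halfBlocked_eq_one hv]
      exact if_neg (by simpa [occupyPair, updatePair, not_iff_not] using hv)
  rw [← Finset.add_sum_erase _ _ (Finset.mem_univ v),
    ← Finset.add_sum_erase _ (disagree p) (Finset.mem_univ v), h]
  simp only [occupyPair]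
  rw [Finset.sum_congr rfl fun w hw => disagree_updatePair_of_ne (Finset.ne_of_mem_erase hw) _ _]
  ring

theorem sum_halfBlocked_erase_le [Fintype V] [DecidableRel G.Adj]
    (p : (V → Bool) × (V → Bool)) (w : V) :
    ∑ v, (halfBlocked G (updatePair p v false false) w - halfBlocked G p w) ≤
      ∑ v ∈ G.neighborFinset w, disagree p v - 2 * halfBlocked G p w := by
  have hnn : 0 ≤ ∑ v ∈ G.neighborFinset w, disagree p v :=
    Finset.sum_nonneg fun v _ => disagree_nonneg p v
  have agree_of_sum : ∀ v, v ∈ G.neighborFinset w →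
      ∑ v ∈ (G.neighborFinset w).erase v, disagree p v < 1 →
      ∀ u, G.Adj w u → u ≠ v → p.1 u = p.2 u := by
    intro v hv hlt u hu huv
    by_contra hne
    have : disagree p u ≤ ∑ v ∈ (G.neighborFinset w).erase v, disagree p v :=
      Finset.single_le_sum (f := disagree p) (fun v _ => disagree_nonneg p v)
        (by simp [huv, hu])
    have h1 : disagree p u = 1 := if_neg hne
    linarith
  by_cases hw : Blocked G p.1 w ↔ Blocked G p.2 w
  · rw [halfBlocked_eq_zero hw]
    simp only [sub_zero, mul_zero]
    by_cases hc : ∃ u, G.Adj w u ∧ p.1 u = true ∧ p.2 u = true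
    · obtain ⟨u, hu, hu1, hu2⟩ := hc
      have hne : ∀ v, v ≠ u → halfBlocked G (updatePair p v false false) w = 0 := by
        intro v hv
        refine halfBlocked_eq_zero ?_
        simp only [updatePair, blocked_update_false]
        exact iff_of_true ⟨u, hu, hv.symm, hu1⟩ ⟨u, hu, hv.symm, hu2⟩
      rw [Finset.sum_eq_single u (fun v _ hv => hne v hv) (by simp)]
      by_cases hag : ∀ x, G.Adj w x → p.1 x = p.2 x
      · rw [halfBlocked_eq_zero_of_agree]
        · exact hnn
        · intro x hx
          by_cases hxu : x = u
          · subst hxu; simp [updatePair]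
          · simp [updatePair, hxu, hag x hx]
      · push Not at hag
        obtain ⟨x, hx, hne⟩ := hag
        have h1 : disagree p x = 1 := if_neg hne
        have : disagree p x ≤ ∑ v ∈ G.neighborFinset w, disagree p v :=
          Finset.single_le_sum (f := disagree p) (fun v _ => disagree_nonneg p v)
            (by simpa using hx)
        linarith [halfBlocked_le_one G (updatePair p u false false) w]
    · rw [← Finset.sum_subset (Finset.subset_univ (G.neighborFinset w))]
      · refine Finset.sum_le_sum fun v hv => ?_
        by_cases hd : p.1 v = p.2 v
        · have hf : p.1 v = false ∧ p.2 v = false := by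
            have : G.Adj w v := by simpa using hv
            have : ¬(p.1 v = true ∧ p.2 v = true) := fun h => hc ⟨v, this, h⟩
            cases h1 : p.1 v <;> cases h2 : p.2 v <;> simp_all
          have : updatePair p v false false = p := by
            simp only [updatePair]
            rw [← hf.1, Function.update_eq_self, hf.1, ← hf.2, Function.update_eq_self]
          rw [this, halfBlocked_eq_zero hw]
          exact disagree_nonneg p v
        · rw [show disagree p v = 1 from if_neg hd]
          exact halfBlocked_le_one _ _ _
      · intro v _ hv
        rw [halfBlocked_updatePair_of_not_adj (by simpa using hv), halfBlocked_eq_zero hw]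
  · have hw1 := halfBlocked_eq_one hw
    have hle : ∀ v, halfBlocked G (updatePair p v false false) w - halfBlocked G p w ≤ 0 := by
      intro v
      linarith [halfBlocked_le_one G (updatePair p v false false) w]
    obtain ⟨v, hv, hne⟩ : ∃ v, G.Adj w v ∧ p.1 v ≠ p.2 v := by
      by_contra hno
      push Not at hno
      rw [halfBlocked_eq_zero_of_agree hno] at hw1
      exact zero_ne_one hw1
    have hv' : v ∈ G.neighborFinset w := by simpa using hv
    have h1 : disagree p v = 1 := if_neg hne
    rw [← Finset.add_sum_erase _ (disagree p) hv', h1, hw1]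
    rw [hw1] at hle
    by_cases hlt : ∑ v ∈ (G.neighborFinset w).erase v, disagree p v < 1
    · have h0 : halfBlocked G (updatePair p v false false) w = 0 := by
        refine halfBlocked_eq_zero_of_agree fun x hx => ?_
        by_cases hxv : x = v
        · subst hxv; simp [updatePair]
        · simp [updatePair, hxv, agree_of_sum v hv' hlt x hx hxv]
      have hs : ∑ x, (halfBlocked G (updatePair p x false false) w - 1) ≤ -1 := by
        rw [← Finset.add_sum_erase _ _ (Finset.mem_univ v), h0]
        linarith [Finset.sum_nonpos fun x (_ : x ∈ Finset.univ.erase v) => hle x]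
      have : 0 ≤ ∑ v ∈ (G.neighborFinset w).erase v, disagree p v :=
        Finset.sum_nonneg fun v _ => disagree_nonneg p v
      linarith
    · linarith [Finset.sum_nonpos fun x (_ : x ∈ Finset.univ) => hle x]

open Classical in
theorem halfBlocked_occupy_sub_le {p : (V → Bool) × (V → Bool)} (h1 : IsIndep G p.1)
    (h2 : IsIndep G p.2) (v w : V) :
    halfBlocked G (occupyPair G p v) w - halfBlocked G p w ≤
      (if G.Adj v w ∧ ¬Blocked G p.1 w ∧ ¬Blocked G p.2 w then halfBlocked G p v else 0) -
      (if G.Adj w v ∧ ¬Blocked G p.1 v ∧ ¬Blocked G p.2 v then halfBlocked G p w else 0) := by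
  by_cases hvw : G.Adj w v
  swap
  · have hwv : ¬G.Adj v w := fun h => hvw h.symm
    simp [hvw, hwv, occupyPair, halfBlocked_updatePair_of_not_adj hvw]
  have hwv := hvw.symm
  have hv0 := halfBlocked_nonneg G p v
  have key : ¬Blocked G p.1 v → ¬Blocked G p.2 v → halfBlocked G (occupyPair G p v) w = 0 := by
    intro ha hb
    refine halfBlocked_eq_zero ?_
    simp only [occupyPair, updatePair, ha, hb, not_false_eq_true, decide_true]
    exact iff_of_true (blocked_update_true hvw) (blocked_update_true hvw)
  by_cases hw : Blocked G p.1 w ↔ Blocked G p.2 w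
  · rw [halfBlocked_eq_zero hw]
    by_cases hb : Blocked G p.1 w
    · have hb' := hw.1 hb
      have : halfBlocked G (occupyPair G p v) w = 0 :=
        halfBlocked_eq_zero (iff_of_true (hb.occupy h1) (hb'.occupy h2))
      simp [this, hb]
    · have hb' : ¬Blocked G p.2 w := fun h => hb (hw.2 h)
      simp only [hwv, hb, hb', not_false_eq_true, and_self, if_true, ite_self, sub_zero]
      by_cases hv : Blocked G p.1 v ↔ Blocked G p.2 v
      · by_cases hbv : Blocked G p.1 v
        · have hbv' := hv.1 hbv
          have hnot : ∀ {σ : V → Bool}, ¬Blocked G σ w →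
              ¬Blocked G (Function.update σ v false) w := by
            intro σ h
            rw [blocked_update_false]
            rintro ⟨u, hu, -, hσ⟩
            exact h ⟨u, hu, hσ⟩
          have : halfBlocked G (occupyPair G p v) w = 0 := by
            refine halfBlocked_eq_zero ?_
            simp only [occupyPair, updatePair, hbv, hbv', not_true, decide_false]
            exact iff_of_false (hnot hb) (hnot hb')
          linarith
        · rw [key hbv fun h => hbv (hv.2 h)]
          exact hv0
      · rw [halfBlocked_eq_one hv]
        exact halfBlocked_le_one _ _ _
  · rw [halfBlocked_eq_one hw]
    have hnw : ¬(¬Blocked G p.1 w ∧ ¬Blocked G p.2 w) := fun h => hw (iff_of_false h.1 h.2)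
    simp only [hnw, and_false, if_false, hvw, true_and]
    split_ifs with hv
    · rw [key hv.1 hv.2]
    · linarith [halfBlocked_le_one G (occupyPair G p v) w]

theorem sum_halfBlocked_occupy_le [Fintype V] {p : (V → Bool) × (V → Bool)} (h1 : IsIndep G p.1)
    (h2 : IsIndep G p.2) :
    ∑ v, ∑ w, (halfBlocked G (occupyPair G p v) w - halfBlocked G p w) ≤ 0 := by
  classical
  refine (Finset.sum_le_sum fun v _ => Finset.sum_le_sum fun w _ =>
    halfBlocked_occupy_sub_le G h1 h2 v w).trans ?_
  simp only [Finset.sum_sub_distrib]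
  rw [sub_nonpos, Finset.sum_comm]

/-- The drift of the potential under the coupled Gibbs sampler for fugacity `lam`, summed
over the choice of the updated vertex. -/
theorem sum_pairPotential_drift_le [Fintype V] [DecidableRel G.Adj] {lam : ℝ} (hlam : 0 < lam)
    {p : (V → Bool) × (V → Bool)}
    (h1 : IsIndep G p.1) (h2 : IsIndep G p.2) :
    ∑ v, (1 / (1 + lam) * pairPotential G (lam / 2) (updatePair p v false false) +
        lam / (1 + lam) * pairPotential G (lam / 2) (occupyPair G p v)) ≤
      Fintype.card V * pairPotential G (lam / 2) p -
        (1 - lam * G.maxDegree / (2 * (1 + lam))) * ∑ v, disagree p v := by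
  have hT : ∑ v, ∑ w, (halfBlocked G (updatePair p v false false) w - halfBlocked G p w) ≤
      G.maxDegree * ∑ v, disagree p v - 2 * ∑ w, halfBlocked G p w := by
    rw [Finset.sum_comm]
    refine (Finset.sum_le_sum fun w _ => sum_halfBlocked_erase_le G p w).trans ?_
    rw [Finset.sum_sub_distrib, ← Finset.mul_sum]
    linarith [sum_neighbor_disagree_le G p]
  have hH := sum_halfBlocked_occupy_le G h1 h2
  have hrew : ∑ v, (1 / (1 + lam) * pairPotential G (lam / 2) (updatePair p v false false) +
        lam / (1 + lam) * pairPotential G (lam / 2) (occupyPair G p v)) =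
      Fintype.card V * pairPotential G (lam / 2) p - ∑ v, disagree p v +
        lam / (1 + lam) * ∑ v, halfBlocked G p v +
        lam / 2 * (1 / (1 + lam)) *
          ∑ v, ∑ w, (halfBlocked G (updatePair p v false false) w - halfBlocked G p w) +
        lam / 2 * (lam / (1 + lam)) *
          ∑ v, ∑ w, (halfBlocked G (occupyPair G p v) w - halfBlocked G p w) := by
    simp only [pairPotential, sum_disagree_erase, sum_disagree_occupy, Finset.sum_sub_distrib,
      Finset.sum_add_distrib, ← Finset.mul_sum, Finset.sum_const, Finset.card_univ, nsmul_eq_mul]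
    field_simp
    ring
  rw [hrew]
  have hT' := mul_le_mul_of_nonneg_left hT (show 0 ≤ lam / 2 * (1 / (1 + lam)) by positivity)
  have hH' := mul_nonpos_of_nonneg_of_nonpos (show 0 ≤ lam / 2 * (lam / (1 + lam)) by positivity) hH
  have e : lam / 2 * (1 / (1 + lam)) *
      (G.maxDegree * ∑ v, disagree p v - 2 * ∑ w, halfBlocked G p w) =
      lam * G.maxDegree / (2 * (1 + lam)) * ∑ v, disagree p v -
        lam / (1 + lam) * ∑ w, halfBlocked G p w := by
    field_simp
  linarith

end Updates

end Hardcore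

theorem sum_hamKernel_pairPotential_le {V : Type*} [Fintype V] [DecidableEq V] [Nonempty V]
    (G : SimpleGraph V) [DecidableRel G.Adj] {δ lam lam' : ℝ} (hδ0 : 0 < δ)
    (hΔ : 3 ≤ G.maxDegree) (hlam0 : 0 < lam) (hlam'0 : 0 < lam')
    (hlam : lam ≤ (2 - δ) / ((G.maxDegree : ℝ) - 2))
    {Dopt : V → (V → Bool) → (V → Bool) → Bool → Bool → ℝ}
    (hDopt : ∀ (v : V) (σ τ : V → Bool),
      IsOptimalCoupling (margHC G lam v σ) (margHC G lam v τ) (Dopt v σ τ))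
    {p : (V → Bool) × (V → Bool)} (h1 : IsIndep G p.1) (h2 : IsIndep G p.2) :
    ∑ p', pairKernel (fun v σ τ =>
        hamCoupling (margHC G lam v τ) (margHC G lam' v τ) (Dopt v σ τ)) p p' *
        pairPotential G (lam / 2) p' ≤
      pairPotential G (lam / 2) p - δ / (6 * Fintype.card V) * ∑ v, disagree p v +
        4 * |Real.log lam - Real.log lam'| := by
  have hn : (0 : ℝ) < Fintype.card V := by exact_mod_cast Fintype.card_pos
  have hΔ' : (3 : ℝ) ≤ G.maxDegree := by exact_mod_cast hΔ
  have hlamΔ : lam * (G.maxDegree - 2) ≤ 2 - δ := by rwa [le_div_iff₀ (by linarith)] at hlam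
  have hlam2 : lam ≤ 2 := by nlinarith
  have hcost : 1 + lam / 2 * G.maxDegree ≤ 4 := by nlinarith
  have hrate : δ / 6 ≤ 1 - lam * G.maxDegree / (2 * (1 + lam)) := by
    rw [one_sub_div (by positivity), le_div_iff₀ (by positivity)]
    nlinarith
  have hd : 0 ≤ ∑ v, disagree p v := Finset.sum_nonneg fun v _ => disagree_nonneg p v
  rw [sum_pairKernel_mul]
  have hlocal : ∀ v, ∑ c, ∑ d,
      hamCoupling (margHC G lam v p.2) (margHC G lam' v p.2) (Dopt v p.1 p.2) c d *
        pairPotential G (lam / 2) (updatePair p v c d) ≤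
      (1 / (1 + lam) * pairPotential G (lam / 2) (updatePair p v false false) +
        lam / (1 + lam) * pairPotential G (lam / 2) (occupyPair G p v)) +
        4 * |Real.log lam - Real.log lam'| := by
    intro v
    have h := sum_hamCoupling_mul_le (f := fun c d => pairPotential G (lam / 2) (updatePair p v c d))
      (K := 4) (margHC_nonneg G hlam0 v p.2) (margHC_nonneg G hlam'0 v p.2)
      ((sum_margHC G hlam0 v p.2).trans (sum_margHC G hlam'0 v p.2).symm) (hDopt v p.1 p.2).1
      (fun c d d' => (pairPotential_updatePair_le G (by positivity) p v c d d').trans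
        (by linarith))
    rw [sum_optimalCoupling_margHC G hlam0 (hDopt v p.1 p.2)] at h
    exact h.trans (by
      have := sum_max_margHC_sub_le G hlam0 hlam'0 v p.2
      unfold occupyPair
      linarith)
  have hsum := Finset.sum_le_sum fun v (_ : v ∈ Finset.univ) => hlocal v
  rw [Finset.sum_add_distrib, Finset.sum_const, Finset.card_univ, nsmul_eq_mul] at hsum
  have hdrift := sum_pairPotential_drift_le G hlam0 h1 h2
  have hrate' := mul_le_mul_of_nonneg_right hrate hd
  rw [inv_mul_le_iff₀ hn]
  refine hsum.trans ?_
  have e : (Fintype.card V : ℝ) * (pairPotential G (lam / 2) p -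
      δ / (6 * Fintype.card V) * ∑ v, disagree p v + 4 * |Real.log lam - Real.log lam'|) =
      Fintype.card V * pairPotential G (lam / 2) p - δ / 6 * ∑ v, disagree p v +
        Fintype.card V * (4 * |Real.log lam - Real.log lam'|) := by
    field_simp
  rw [e]
  linarith

/-- For hardcore instances `I = (V,E,λ)` and `I' = (V,E,λ')` on the same graph
with `Δ ≥ 3`, `λ ≤ (2−δ)/(Δ−2)` and `d_Ham(I,I') = n·|ln λ − ln λ'| ≤ L`, the one-step local
coupling for Hamiltonian update run for `T` steps from `X_0 = Y_0 = 0^V`, with constant filter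
probabilities `p̂ = min{2|ln λ − ln λ'|, 1}`, satisfies
`E[R_Ham] ≤ 50000·Δ²·T·L/(δ·n)`.
The expectation of `R_Ham = Σ_{t=1}^T 1{t ∈ P ∨ v_t ∈ Γ⁺(D_{t−1})}` is written in closed
form: conditionally on the pair state at time `t−1`,
`Pr[t ∈ P ∨ v_t ∈ Γ⁺(D_{t−1})] = n⁻¹ Σ_v (p̂ + (1 − p̂)·1{v ∈ Γ⁺(D_{t−1})})`. -/
theorem hardcore_expected_R_Ham_bound
    {V : Type*} [Fintype V] [DecidableEq V] [Nonempty V]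
    (G : SimpleGraph V) [DecidableRel G.Adj]
    (δ lam lam' L : ℝ) (T : ℕ)
    (hδ0 : 0 < δ) (hδ1 : δ ≤ 1)
    (hΔ : 3 ≤ G.maxDegree)
    (hlam0 : 0 < lam) (hlam'0 : 0 < lam')
    (hlam : lam ≤ (2 - δ) / ((G.maxDegree : ℝ) - 2))
    (hL : (Fintype.card V : ℝ) * |Real.log lam - Real.log lam'| ≤ L)
    (Dopt : V → (V → Bool) → (V → Bool) → Bool → Bool → ℝ)
    (hDopt : ∀ (v : V) (σ τ : V → Bool),
      IsOptimalCoupling (margHC G lam v σ) (margHC G lam v τ) (Dopt v σ τ)) :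
    ∑ t ∈ Finset.range T,
        ∑ p : (V → Bool) × (V → Bool),
          chainDist
            (pairKernel fun v σ τ =>
              hamCoupling (margHC G lam v τ) (margHC G lam' v τ) (Dopt v σ τ))
            (initDelta (((fun _ => false) : V → Bool), ((fun _ => false) : V → Bool))) t p *
          ((Fintype.card V : ℝ)⁻¹ *
            ∑ v : V, (min (2 * |Real.log lam - Real.log lam'|) 1 +
              (1 - min (2 * |Real.log lam - Real.log lam'|) 1) * indNbr G p v))
      ≤ 50000 * (G.maxDegree : ℝ) ^ 2 * T * L / (δ * (Fintype.card V : ℝ)) := by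
  set ℓ := |Real.log lam - Real.log lam'| with hℓ
  set P := pairKernel fun v σ τ =>
    hamCoupling (margHC G lam v τ) (margHC G lam' v τ) (Dopt v σ τ) with hPdef
  set s₀ : (V → Bool) × (V → Bool) := (fun _ => false, fun _ => false)
  have hn : (0 : ℝ) < Fintype.card V := by exact_mod_cast Fintype.card_pos
  have hℓ0 : 0 ≤ ℓ := abs_nonneg _
  have hΔ' : (3 : ℝ) ≤ G.maxDegree := by exact_mod_cast hΔ
  have hham : ∀ v σ τ c d,
      0 ≤ hamCoupling (margHC G lam v τ) (margHC G lam' v τ) (Dopt v σ τ) c d :=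
    fun v σ τ => hamCoupling_nonneg (margHC_nonneg G hlam0 v τ) (margHC_nonneg G hlam'0 v τ)
      (hDopt v σ τ).1.1
  have hP : ∀ s s', 0 ≤ P s s' := by
    intro s s'
    refine mul_nonneg (inv_nonneg.2 hn.le) (Finset.sum_nonneg fun v _ => ?_)
    split_ifs
    exacts [hham _ _ _ _ _, le_rfl]
  have hP1 : ∀ s, ∑ s', P s s' = 1 := by
    intro s
    have h := sum_pairKernel_mul (fun v σ τ =>
      hamCoupling (margHC G lam v τ) (margHC G lam' v τ) (Dopt v σ τ)) s (fun _ => 1)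
    simp only [mul_one] at h
    rw [hPdef, h]
    have h1 : ∀ v, ∑ c, ∑ d, hamCoupling (margHC G lam v s.2) (margHC G lam' v s.2)
        (Dopt v s.1 s.2) c d = 1 := by
      intro v
      rw [sum_hamCoupling ((sum_margHC G hlam0 v s.2).trans (sum_margHC G hlam'0 v s.2).symm),
        Finset.sum_congr rfl fun c _ => (hDopt v s.1 s.2).1.2.1 c, sum_margHC G hlam0]
    simp only [h1]
    simp
  have hInv : ∀ s s' : (V → Bool) × (V → Bool), IsIndep G s.1 ∧ IsIndep G s.2 → P s s' ≠ 0 →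
      IsIndep G s'.1 ∧ IsIndep G s'.2 := by
    rintro s s' ⟨h1, h2⟩ hs
    obtain ⟨v, ha, hb, hne⟩ := exists_of_pairKernel_ne_zero hs
    obtain ⟨hc, hd⟩ := not_blocked_of_hamCoupling_ne_zero G (hDopt v s.1 s.2).1 hne
    exact ⟨h1.of_agree_off ha hc, h2.of_agree_off hb hd⟩
  have hacc := sum_expectation_le_of_drift (Inv := fun s => IsIndep G s.1 ∧ IsIndep G s.2)
    (s₀ := s₀) (K := 4 * ℓ) hP hP1 ⟨by simp [IsIndep, s₀], by simp [IsIndep, s₀]⟩ hInv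
    (pairPotential_nonneg G (show 0 ≤ lam / 2 by positivity))
    (fun s hs => sum_hamKernel_pairPotential_le G hδ0 hΔ hlam0 hlam'0 hlam hDopt hs.1 hs.2) T
  have hΦ0 : pairPotential G (lam / 2) s₀ = 0 := by
    simp [pairPotential, disagree, halfBlocked, s₀]
  rw [hΦ0, zero_add] at hacc
  have hnn := chainDist_nonneg (init := initDelta s₀) hP
    (fun s => by unfold initDelta; split_ifs <;> norm_num)
  set a := min (2 * ℓ) 1
  have ha0 : 0 ≤ a := le_min (by positivity) zero_le_one
  have hterm : ∀ p : (V → Bool) × (V → Bool),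
      (Fintype.card V : ℝ)⁻¹ * ∑ v : V, (a + (1 - a) * indNbr G p v) ≤
      2 * ℓ + 6 * (G.maxDegree + 1) / δ * (δ / (6 * Fintype.card V) * ∑ v, disagree p v) := by
    intro p
    have hi := sum_indNbr_le G p
    have hi0 : ∀ v, 0 ≤ indNbr G p v := by
      intro v; unfold indNbr; split_ifs <;> norm_num
    have hi1 : 0 ≤ ∑ v, indNbr G p v := Finset.sum_nonneg fun v _ => hi0 v
    have ha2 : a ≤ 2 * ℓ := min_le_left _ _
    rw [inv_mul_le_iff₀ hn, Finset.sum_add_distrib, ← Finset.mul_sum, Finset.sum_const,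
      Finset.card_univ, nsmul_eq_mul]
    have e : (Fintype.card V : ℝ) * (2 * ℓ + 6 * (G.maxDegree + 1) / δ *
        (δ / (6 * Fintype.card V) * ∑ v, disagree p v)) =
        Fintype.card V * (2 * ℓ) + (G.maxDegree + 1) * ∑ v, disagree p v := by
      field_simp
    rw [e]
    have := mul_le_mul_of_nonneg_left ha2 hn.le
    nlinarith [mul_nonneg ha0 hi1]
  calc _ ≤ ∑ t ∈ Finset.range T, ∑ p, chainDist P (initDelta s₀) t p *
        (2 * ℓ + 6 * (G.maxDegree + 1) / δ *
          (δ / (6 * Fintype.card V) * ∑ v, disagree p v)) :=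
        Finset.sum_le_sum fun t _ => Finset.sum_le_sum fun p _ =>
          mul_le_mul_of_nonneg_left (hterm p) (hnn t p)
    _ = T * (2 * ℓ) + 6 * (G.maxDegree + 1) / δ * ∑ t ∈ Finset.range T, ∑ p,
        chainDist P (initDelta s₀) t p * (δ / (6 * Fintype.card V) * ∑ v, disagree p v) := by
        simp only [mul_add, Finset.sum_add_distrib, ← Finset.sum_mul, sum_chainDist_eq_one hP1]
        congr 1
        · simp
        · simp only [Finset.mul_sum]
          refine Finset.sum_congr rfl fun t _ => Finset.sum_congr rfl fun p _ =>
            Finset.sum_congr rfl fun v _ => by ring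
    _ ≤ T * (2 * ℓ) + 6 * (G.maxDegree + 1) / δ * (T * (4 * ℓ)) := by gcongr
    _ ≤ 50000 * (G.maxDegree : ℝ) ^ 2 * T * ℓ / δ := by
        rw [le_div_iff₀ hδ0]
        have e : (T * (2 * ℓ) + 6 * ((G.maxDegree : ℝ) + 1) / δ * (T * (4 * ℓ))) * δ =
            (2 * δ + 24 * (G.maxDegree + 1)) * (T * ℓ) := by
          field_simp
          ring
        rw [e, mul_assoc (50000 * (G.maxDegree : ℝ) ^ 2)]
        exact mul_le_mul_of_nonneg_right (by nlinarith) (by positivity)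
    _ ≤ 50000 * (G.maxDegree : ℝ) ^ 2 * T * L / (δ * (Fintype.card V : ℝ)) := by
        rw [div_le_div_iff₀ hδ0 (by positivity)]
        have := mul_le_mul_of_nonneg_left hL
          (show 0 ≤ 50000 * (G.maxDegree : ℝ) ^ 2 * T * δ by positivity)
        linarith
end
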